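/- Let p be a prime number and let A, B, C be any three points in [0, p−1] × [0, p−1], and let T be the triangle with vertices A, B, C (their convex hull). Let 𝓘(T) denote the number of pairs of positive integers (x, y) lying in T with xy ≡ 1 (mod p). Then |𝓘(T) − Area(T)/p| < 12 · p^{3/4} · log p, where log denotes the natural logarithm. -/

import Mathlib

open MeasureTheory

/-- The number of points `(x, y)` with positive integer coordinates lying in the
set `S ⊆ ℝ²` and satisfying `x y ≡ 1 (mod p)`. -/
noncomputable def invCount (p : ℕ) (S : Set (ℝ × ℝ)) : ℕ :=
  ({xy : ℕ × ℕ | 0 < xy.1 ∧ 0 < xy.2 ∧ ((xy.1 : ℝ), (xy.2 : ℝ)) ∈ S ∧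
    xy.1 * xy.2 ≡ 1 [MOD p]}).ncard

open Finset in
theorem units_add_inv_quadruples_card_le (F : Type*) [Field F] [Fintype F] [DecidableEq F] :
    #{t : (Fˣ × Fˣ) × (Fˣ × Fˣ) | (t.1.1 : F) + t.1.2 = t.2.1 + t.2.2 ∧
        ((t.1.1⁻¹ : Fˣ) : F) + (t.1.2⁻¹ : Fˣ) = (t.2.1⁻¹ : Fˣ) + (t.2.2⁻¹ : Fˣ)} ≤
      3 * Fintype.card Fˣ ^ 2 := by
  classical
  have hsub : ({t : (Fˣ × Fˣ) × (Fˣ × Fˣ) | (t.1.1 : F) + t.1.2 = t.2.1 + t.2.2 ∧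
        ((t.1.1⁻¹ : Fˣ) : F) + (t.1.2⁻¹ : Fˣ) = (t.2.1⁻¹ : Fˣ) + (t.2.2⁻¹ : Fˣ)} : Finset _) ⊆
      ((univ : Finset (Fˣ × Fˣ)).image (fun s => (s, s)) ∪
        (univ : Finset (Fˣ × Fˣ)).image (fun s => (s, s.swap))) ∪
        (univ : Finset (Fˣ × Fˣ)).image (fun s => ((s.1, -s.1), (s.2, -s.2))) := by
    rintro ⟨⟨a, b⟩, ⟨c, d⟩⟩ h
    simp only [mem_filter, mem_univ, true_and] at h
    obtain ⟨h1, h2⟩ := h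
    simp only [Units.val_inv_eq_inv_val] at h2
    have ha := a.ne_zero
    have hb := b.ne_zero
    have hc := c.ne_zero
    have hd := d.ne_zero
    have h3 : ((a : F) + b) * ((c : F) * d - a * b) = 0 := by
      field_simp at h2
      linear_combination h2 - (a : F) * b * h1
    simp only [mem_union, mem_image, mem_univ, true_and, Prod.mk.injEq, Prod.exists,
      Prod.swap_prod_mk]
    rcases mul_eq_zero.1 h3 with h | h
    · right
      refine ⟨a, c, ⟨rfl, ?_⟩, rfl, ?_⟩
      · ext; push_cast; linear_combination -h
      · ext; push_cast; linear_combination h1 - h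
    · left
      have h4 : ((a : F) - c) * ((a : F) - d) = 0 := by linear_combination h + (a : F) * h1
      rcases mul_eq_zero.1 h4 with h5 | h5
      · left
        refine ⟨a, b, ⟨rfl, rfl⟩, ?_, ?_⟩
        · ext; linear_combination h5
        · ext; linear_combination h1 - h5
      · right
        refine ⟨a, b, ⟨rfl, rfl⟩, ?_, ?_⟩
        · ext; linear_combination h1 - h5
        · ext; linear_combination h5
  refine (card_le_card hsub).trans ?_
  refine (card_union_le _ _).trans ?_
  have hc : #(univ : Finset (Fˣ × Fˣ)) = Fintype.card Fˣ ^ 2 := by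
    rw [card_univ, Fintype.card_prod, sq]
  have h1 := card_union_le ((univ : Finset (Fˣ × Fˣ)).image (fun s => (s, s)))
        ((univ : Finset (Fˣ × Fˣ)).image (fun s => (s, s.swap)))
  have h2 := card_image_le (s := (univ : Finset (Fˣ × Fˣ))) (f := fun s => (s, s))
  have h3 := card_image_le (s := (univ : Finset (Fˣ × Fˣ))) (f := fun s => (s, s.swap))
  have h4 := card_image_le (s := (univ : Finset (Fˣ × Fˣ)))
    (f := fun s => ((s.1, -s.1), (s.2, -s.2)))
  omega

/-- The Kloosterman sum `∑ u, e((a u + c u⁻¹) / p)` over the units modulo `p`. -/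
noncomputable def kloostermanSum (p : ℕ) [Fact p.Prime] (a c : ZMod p) : ℂ :=
  ∑ u : (ZMod p)ˣ, ZMod.stdAddChar (N := p) (a * u + c * (u⁻¹ : (ZMod p)ˣ))

section Kloosterman

variable (p : ℕ) [Fact p.Prime]

theorem sum_stdAddChar_mul (s : ZMod p) :
    ∑ a : ZMod p, (ZMod.stdAddChar (N := p) (a * s) : ℂ) = if s = 0 then (p : ℂ) else 0 := by
  have := AddChar.sum_mulShift (R := ZMod p) (R' := ℂ) s (ZMod.isPrimitive_stdAddChar p)
  rw [this, ZMod.card]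
  push_cast
  rfl

theorem norm_kloostermanSum_pow_four (a c : ZMod p) :
    ((‖kloostermanSum p a c‖ ^ 4 : ℝ) : ℂ) =
      ∑ t : ((ZMod p)ˣ × (ZMod p)ˣ) × ((ZMod p)ˣ × (ZMod p)ˣ),
        ZMod.stdAddChar (N := p) (a * ((t.1.1 : ZMod p) + t.1.2 - (t.2.1 + t.2.2))) *
        ZMod.stdAddChar (N := p) (c * (((t.1.1⁻¹ : (ZMod p)ˣ) : ZMod p) + (t.1.2⁻¹ : (ZMod p)ˣ) -
          ((t.2.1⁻¹ : (ZMod p)ˣ) + (t.2.2⁻¹ : (ZMod p)ˣ)))) := by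
  have h : ((‖kloostermanSum p a c‖ ^ 4 : ℝ) : ℂ) =
      (kloostermanSum p a c * kloostermanSum p a c) *
      (starRingEnd ℂ (kloostermanSum p a c) * starRingEnd ℂ (kloostermanSum p a c)) := by
    have := Complex.mul_conj' (kloostermanSum p a c)
    push_cast
    linear_combination (-(‖kloostermanSum p a c‖ : ℂ) ^ 2 -
      kloostermanSum p a c * starRingEnd ℂ (kloostermanSum p a c)) * this
  rw [h]
  have hconj : starRingEnd ℂ (kloostermanSum p a c) =
      ∑ u : (ZMod p)ˣ, ZMod.stdAddChar (N := p) (-(a * u + c * (u⁻¹ : (ZMod p)ˣ))) := by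
    rw [kloostermanSum, map_sum]
    refine Finset.sum_congr rfl fun u _ => ?_
    rw [AddChar.map_neg_eq_conj]
  rw [hconj, kloostermanSum, Fintype.sum_mul_sum, Fintype.sum_mul_sum, ← Fintype.sum_prod_type',
    ← Fintype.sum_prod_type', Fintype.sum_mul_sum, ← Fintype.sum_prod_type']
  refine Finset.sum_congr rfl fun t _ => ?_
  simp only [← AddChar.map_add_eq_mul]
  congr 1
  ring

theorem sum_sum_norm_kloostermanSum_pow_four_le :
    ∑ c : ZMod p, ∑ a : ZMod p, ‖kloostermanSum p a c‖ ^ 4 ≤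
      (p : ℝ) ^ 2 * (3 * ((p : ℝ) - 1) ^ 2) := by
  have hcard := units_add_inv_quadruples_card_le (ZMod p)
  set Q := ({t : ((ZMod p)ˣ × (ZMod p)ˣ) × ((ZMod p)ˣ × (ZMod p)ˣ) |
        (t.1.1 : ZMod p) + t.1.2 = t.2.1 + t.2.2 ∧
        ((t.1.1⁻¹ : (ZMod p)ˣ) : ZMod p) + (t.1.2⁻¹ : (ZMod p)ˣ) =
          (t.2.1⁻¹ : (ZMod p)ˣ) + (t.2.2⁻¹ : (ZMod p)ˣ)} : Finset _) with hQ
  have hp1 : 1 ≤ p := (Fact.out : p.Prime).one_lt.le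
  rw [ZMod.card_units_eq_totient, Nat.totient_prime Fact.out] at hcard
  have hcard' : (Q.card : ℝ) ≤ 3 * ((p : ℝ) - 1) ^ 2 := by
    have : (Q.card : ℝ) ≤ ((3 * (p - 1) ^ 2 : ℕ) : ℝ) := by exact_mod_cast hcard
    rwa [Nat.cast_mul, Nat.cast_pow, Nat.cast_sub hp1, Nat.cast_ofNat, Nat.cast_one] at this
  have key : ((∑ c : ZMod p, ∑ a : ZMod p, ‖kloostermanSum p a c‖ ^ 4 : ℝ) : ℂ) =
      (((p : ℝ) ^ 2 * Q.card : ℝ) : ℂ) := by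
    rw [Complex.ofReal_sum]
    simp_rw [Complex.ofReal_sum, norm_kloostermanSum_pow_four]
    calc _ = ∑ c : ZMod p, ∑ t : ((ZMod p)ˣ × (ZMod p)ˣ) × ((ZMod p)ˣ × (ZMod p)ˣ),
        (∑ a : ZMod p,
          ZMod.stdAddChar (N := p) (a * ((t.1.1 : ZMod p) + t.1.2 - (t.2.1 + t.2.2)))) *
        ZMod.stdAddChar (N := p) (c * (((t.1.1⁻¹ : (ZMod p)ˣ) : ZMod p) + (t.1.2⁻¹ : (ZMod p)ˣ) -
          ((t.2.1⁻¹ : (ZMod p)ˣ) + (t.2.2⁻¹ : (ZMod p)ˣ)))) := by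
            refine Finset.sum_congr rfl fun c _ => ?_
            rw [Finset.sum_comm]
            simp_rw [Finset.sum_mul]
      _ = ∑ t : ((ZMod p)ˣ × (ZMod p)ˣ) × ((ZMod p)ˣ × (ZMod p)ˣ),
        if t ∈ Q then (p : ℂ) ^ 2 else 0 := by
            rw [Finset.sum_comm]
            refine Finset.sum_congr rfl fun t _ => ?_
            rw [← Finset.mul_sum, sum_stdAddChar_mul, sum_stdAddChar_mul]
            simp only [hQ, Finset.mem_filter, Finset.mem_univ, true_and, sub_eq_zero]
            split_ifs <;> first | (exfalso; tauto) | ring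
      _ = _ := by
            rw [Finset.sum_ite_mem, Finset.univ_inter, Finset.sum_const]
            push_cast
            rw [nsmul_eq_mul, mul_comm]
  rw [Complex.ofReal_inj.1 key]
  gcongr

theorem sum_norm_kloostermanSum_pow_four_le {c : ZMod p} (hc : c ≠ 0) :
    ∑ a : ZMod p, ‖kloostermanSum p a c‖ ^ 4 ≤ 3 * (p : ℝ) ^ 3 := by
  have hscale : ∀ c : ZMod p, c ≠ 0 → ∑ a : ZMod p, ‖kloostermanSum p a c‖ ^ 4 =
      ∑ a : ZMod p, ‖kloostermanSum p a 1‖ ^ 4 := by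
    intro c hc
    refine Fintype.sum_equiv (Equiv.mulRight₀ c hc) _ _ fun a => ?_
    congr 2
    refine Fintype.sum_equiv (Equiv.mulRight (Units.mk0 c hc)⁻¹) _ _ fun u => ?_
    congr 1
    have hu := u.ne_zero
    simp only [Equiv.coe_mulRight, Equiv.mulRight₀_apply, Units.val_mul, Units.val_inv_eq_inv_val,
      Units.val_mk0]
    field_simp
  have h := sum_sum_norm_kloostermanSum_pow_four_le p
  have hp : (1 : ℝ) < p := by exact_mod_cast (Fact.out : p.Prime).one_lt
  rw [hscale c hc]
  set X := ∑ a : ZMod p, ‖kloostermanSum p a 1‖ ^ 4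
  have h2 : ((p : ℝ) - 1) * X ≤ ∑ c : ZMod p, ∑ a : ZMod p, ‖kloostermanSum p a c‖ ^ 4 := by
    calc ((p : ℝ) - 1) * X = ∑ c ∈ Finset.univ.erase (0 : ZMod p), X := by
          rw [Finset.sum_const, Finset.card_erase_of_mem (Finset.mem_univ _), Finset.card_univ,
            ZMod.card, nsmul_eq_mul, Nat.cast_sub (by exact_mod_cast hp.le), Nat.cast_one]
      _ = ∑ c ∈ Finset.univ.erase (0 : ZMod p), ∑ a : ZMod p, ‖kloostermanSum p a c‖ ^ 4 :=
          Finset.sum_congr rfl fun c hc => (hscale c (Finset.ne_of_mem_erase hc)).symm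
      _ ≤ _ := Finset.sum_le_sum_of_subset_of_nonneg (Finset.erase_subset _ _)
          fun _ _ _ => by positivity
  have h3 : ((p : ℝ) - 1) * X ≤ ((p : ℝ) - 1) * (3 * p ^ 2 * (p - 1)) := by linarith
  have h4 := le_of_mul_le_mul_left h3 (by linarith)
  nlinarith [sq_nonneg (p : ℝ)]

end Kloosterman

theorem add_one_rpow_neg_four_thirds_le (j : ℕ) :
    ((j : ℝ) + 2) ^ (-(4 / 3) : ℝ) ≤
      3 * (((j : ℝ) + 1) ^ (-(1 / 3) : ℝ) - ((j : ℝ) + 2) ^ (-(1 / 3) : ℝ)) := by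
  have h1 : (0 : ℝ) < (j : ℝ) + 1 := by positivity
  have h2 : (0 : ℝ) < (j : ℝ) + 2 := by positivity
  set x := ((j : ℝ) + 1) ^ (1 / 3 : ℝ) with hx
  set y := ((j : ℝ) + 2) ^ (1 / 3 : ℝ) with hy
  have hx0 : 0 < x := Real.rpow_pos_of_pos h1 _
  have hy0 : 0 < y := Real.rpow_pos_of_pos h2 _
  have hxy : x ≤ y := Real.rpow_le_rpow h1.le (by linarith) (by norm_num)
  have hx3 : x ^ 3 = (j : ℝ) + 1 := by
    rw [hx, ← Real.rpow_natCast, ← Real.rpow_mul h1.le]; norm_num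
  have hy3 : y ^ 3 = (j : ℝ) + 2 := by
    rw [hy, ← Real.rpow_natCast, ← Real.rpow_mul h2.le]; norm_num
  have e1 : ((j : ℝ) + 2) ^ (-(4 / 3) : ℝ) = 1 / y ^ 4 := by
    rw [hy, ← Real.rpow_natCast, ← Real.rpow_mul h2.le, Real.rpow_neg h2.le, one_div]; norm_num
  rw [e1, Real.rpow_neg h1.le, Real.rpow_neg h2.le, ← hx, ← hy]
  have e2 : 3 * (x⁻¹ - y⁻¹) = 3 / (x * y * (y ^ 2 + x * y + x ^ 2)) := by
    field_simp
    linear_combination hy3 - hx3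
  rw [e2, div_le_div_iff₀ (by positivity) (by positivity)]
  have h3 : x * y ≤ y * y := by gcongr
  have h4 : x ^ 2 ≤ y ^ 2 := by gcongr
  have : x * y * (y ^ 2 + x * y + x ^ 2) ≤ (y * y) * (y ^ 2 + y * y + y ^ 2) := by gcongr
  nlinarith

theorem sum_add_one_rpow_neg_four_thirds_le (n : ℕ) :
    ∑ j ∈ Finset.range n, ((j : ℝ) + 1) ^ (-(4 / 3) : ℝ) ≤ 4 := by
  have h : ∀ n : ℕ, ∑ j ∈ Finset.range (n + 1), ((j : ℝ) + 1) ^ (-(4 / 3) : ℝ) ≤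
      4 - 3 * ((n : ℝ) + 1) ^ (-(1 / 3) : ℝ) := by
    intro n
    induction n with
    | zero => norm_num
    | succ n ih =>
      rw [Finset.sum_range_succ]
      have := add_one_rpow_neg_four_thirds_le n
      push_cast
      rw [show (n : ℝ) + 1 + 1 = n + 2 by ring]
      linarith
  cases n with
  | zero => norm_num
  | succ n =>
    have h0 : 0 ≤ ((n : ℝ) + 1) ^ (-(1 / 3) : ℝ) := by positivity
    linarith [h n]

/-- The additive character `x ↦ exp(2πix)` of the reals. -/
noncomputable def expChar (x : ℝ) : ℂ := Complex.exp ((2 * Real.pi * x : ℝ) * Complex.I)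

theorem expChar_add (x y : ℝ) : expChar (x + y) = expChar x * expChar y := by
  rw [expChar, expChar, expChar, ← Complex.exp_add]; congr 1; push_cast; ring

theorem norm_expChar (x : ℝ) : ‖expChar x‖ = 1 := Complex.norm_exp_ofReal_mul_I _

theorem expChar_natCast_mul (n : ℕ) (x : ℝ) : expChar (n * x) = expChar x ^ n := by
  rw [expChar, expChar, ← Complex.exp_nat_mul]; congr 1; push_cast; ring

theorem stdAddChar_intCast_eq_expChar (p : ℕ) [NeZero p] (j : ℤ) :
    ZMod.stdAddChar (N := p) (j : ZMod p) = expChar (j / p) := by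
  rw [ZMod.stdAddChar_coe, expChar]; congr 1; push_cast; ring

theorem norm_expChar_sub_one (x : ℝ) : ‖expChar x - 1‖ = 2 * |Real.sin (Real.pi * x)| := by
  rw [expChar, mul_comm, Complex.norm_exp_I_mul_ofReal_sub_one, norm_mul, Real.norm_eq_abs,
    Real.norm_eq_abs, abs_of_pos (by norm_num : (0 : ℝ) < 2)]
  congr 3; ring

theorem norm_expChar_sub_one_le (x : ℝ) : ‖expChar x - 1‖ ≤ 2 * Real.pi * |x| := by
  rw [norm_expChar_sub_one]
  have := Real.abs_sin_le_abs (x := Real.pi * x)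
  rw [abs_mul, abs_of_pos Real.pi_pos] at this
  linarith

theorem four_mul_min_le_norm_expChar_sub_one {x : ℝ} (h0 : 0 ≤ x) (h1 : x ≤ 1) :
    4 * min x (1 - x) ≤ ‖expChar x - 1‖ := by
  rw [norm_expChar_sub_one]
  have hpi := Real.pi_pos
  have key : ∀ t : ℝ, 0 ≤ t → t ≤ 1 / 2 → 2 * t ≤ Real.sin (Real.pi * t) := by
    intro t ht0 ht1
    have := Real.mul_le_sin (x := Real.pi * t) (by positivity) (by nlinarith)
    have e : 2 / Real.pi * (Real.pi * t) = 2 * t := by field_simp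
    linarith
  rcases le_total x (1 / 2) with h | h
  · have := key x h0 h
    have := le_abs_self (Real.sin (Real.pi * x))
    have := min_le_left x (1 - x)
    linarith
  · have := key (1 - x) (by linarith) (by linarith)
    rw [show Real.pi * (1 - x) = Real.pi - Real.pi * x by ring, Real.sin_pi_sub] at this
    have := le_abs_self (Real.sin (Real.pi * x))
    have := min_le_right x (1 - x)
    linarith

theorem norm_sum_expChar_Ico_mul_le (x : ℝ) (m n : ℕ) :
    ‖∑ u ∈ Finset.Ico m n, expChar (x * u)‖ * ‖expChar x - 1‖ ≤ 2 := by
  rcases le_or_gt n m with h | h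
  · simp [Finset.Ico_eq_empty_of_le h]
  · simp_rw [mul_comm x, expChar_natCast_mul]
    rw [← norm_mul, geom_sum_Ico_mul _ h.le]
    refine (norm_sub_le _ _).trans ?_
    rw [norm_pow, norm_pow, norm_expChar]; norm_num
theorem sum_inv_min_add_one_rpow_le (p : ℕ) :
    ∑ j ∈ Finset.range p, (1 / (min (j : ℝ) ((p : ℝ) - 1 - j) + 1)) ^ (4 / 3 : ℝ) ≤ 8 := by
  have h : ∀ j ∈ Finset.range p, (1 / (min (j : ℝ) ((p : ℝ) - 1 - j) + 1)) ^ (4 / 3 : ℝ) ≤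
      ((j : ℝ) + 1) ^ (-(4 / 3) : ℝ) + (((p - 1 - j : ℕ) : ℝ) + 1) ^ (-(4 / 3) : ℝ) := by
    intro j hj
    have hj' := Finset.mem_range.1 hj
    have e : ((p - 1 - j : ℕ) : ℝ) = (p : ℝ) - 1 - j := by
      rw [Nat.cast_sub (by omega), Nat.cast_sub (by omega), Nat.cast_one]
    have e0 : (0 : ℝ) ≤ (p : ℝ) - 1 - j := by rw [← e]; positivity
    have hrw : ∀ t : ℝ, 0 ≤ t → (1 / (t + 1)) ^ (4 / 3 : ℝ) = (t + 1) ^ (-(4 / 3) : ℝ) := by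
      intro t ht
      rw [one_div, Real.inv_rpow (by positivity), Real.rpow_neg (by positivity)]
    rw [e]
    rcases min_choice (j : ℝ) ((p : ℝ) - 1 - j) with hm | hm
    · rw [hm, hrw _ (by positivity)]
      have : 0 ≤ ((p : ℝ) - 1 - j + 1) ^ (-(4 / 3) : ℝ) := by positivity
      linarith
    · rw [hm, hrw _ e0]
      have : 0 ≤ ((j : ℝ) + 1) ^ (-(4 / 3) : ℝ) := by positivity
      linarith
  refine (Finset.sum_le_sum h).trans ?_
  rw [Finset.sum_add_distrib,
    Finset.sum_range_reflect (fun j : ℕ => ((j : ℝ) + 1) ^ (-(4 / 3) : ℝ)) p]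
  linarith [sum_add_one_rpow_neg_four_thirds_le p]

theorem norm_sum_expChar_shift_le {p m n j : ℕ} (hn : n ≤ p) (hj : j < p) {η : ℝ}
    (h0 : 0 ≤ η) (h1 : η < 1) :
    ‖∑ u ∈ Finset.Ico m n, expChar ((η + j) / p * u)‖ ≤
      p * (1 / (min (j : ℝ) ((p : ℝ) - 1 - j) + 1)) := by
  have hp : (0 : ℝ) < p := by exact_mod_cast (by omega : 0 < p)
  have htriv : ‖∑ u ∈ Finset.Ico m n, expChar ((η + j) / p * u)‖ ≤ p := by
    refine (norm_sum_le _ _).trans ?_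
    simp only [norm_expChar, Finset.sum_const, Nat.card_Ico, nsmul_eq_mul, mul_one]
    exact_mod_cast (by omega : n - m ≤ p)
  have hjp : (j : ℝ) + 1 ≤ p := by exact_mod_cast hj
  obtain ⟨k, hk⟩ : ∃ k : ℕ, min (j : ℝ) ((p : ℝ) - 1 - j) = k := by
    refine ⟨min j (p - 1 - j), ?_⟩
    push_cast
    rw [Nat.cast_sub (by omega), Nat.cast_sub (by omega), Nat.cast_one]
  rw [hk]
  rcases Nat.eq_zero_or_pos k with rfl | hkpos
  · simpa using htriv
  have hk1 : (1 : ℝ) ≤ k := by exact_mod_cast hkpos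
  have hkj : (k : ℝ) ≤ j := hk ▸ min_le_left _ _
  have hkp : (k : ℝ) ≤ (p : ℝ) - 1 - j := hk ▸ min_le_right _ _
  have hx0 : 0 ≤ (η + j) / p := by positivity
  have hx1 : (η + j) / p ≤ 1 := by rw [div_le_one hp]; linarith
  have hmin : (k : ℝ) / p ≤ min ((η + j) / p) (1 - (η + j) / p) := by
    refine le_min (by gcongr; linarith) ?_
    rw [le_sub_iff_add_le, ← add_div, div_le_one hp]; linarith
  have h2 := four_mul_min_le_norm_expChar_sub_one hx0 hx1
  have h3 := norm_sum_expChar_Ico_mul_le ((η + j) / p) m n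
  set X := ‖∑ u ∈ Finset.Ico m n, expChar ((η + j) / p * u)‖ with hX
  have hX0 : 0 ≤ X := norm_nonneg _
  have h4 : X * (4 * (k / p)) ≤ 2 := by
    refine le_trans ?_ h3
    gcongr
    linarith
  have h5 : X * (4 * k) ≤ 2 * p := by
    have : X * (4 * (k / p)) = X * (4 * k) / p := by ring
    rwa [this, div_le_iff₀ hp] at h4
  rw [mul_one_div, le_div_iff₀ (by positivity)]
  nlinarith

section IncompleteSums

variable (p : ℕ) [Fact p.Prime]

/-- The function `u ↦ e(c u⁻¹ / p)` on the units modulo `p`, extended by zero. -/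
noncomputable def invChar (c x : ZMod p) : ℂ :=
  if x = 0 then 0 else ZMod.stdAddChar (N := p) (c * x⁻¹)

theorem sum_kloostermanSum_mul (c x : ZMod p) :
    ∑ a : ZMod p, kloostermanSum p a c * ZMod.stdAddChar (N := p) (-(a * x)) =
      p * invChar p c x := by
  have h : ∀ a : ZMod p, kloostermanSum p a c * ZMod.stdAddChar (N := p) (-(a * x)) =
      ∑ u : (ZMod p)ˣ, ZMod.stdAddChar (N := p) (a * (u - x)) *
        ZMod.stdAddChar (N := p) (c * (u⁻¹ : (ZMod p)ˣ)) := by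
    intro a
    rw [kloostermanSum, Finset.sum_mul]
    refine Finset.sum_congr rfl fun u _ => ?_
    rw [← AddChar.map_add_eq_mul, ← AddChar.map_add_eq_mul]
    congr 1
    ring
  simp_rw [h]
  rw [Finset.sum_comm]
  simp_rw [← Finset.sum_mul, sum_stdAddChar_mul, sub_eq_zero, ite_mul, zero_mul]
  rw [invChar]
  split_ifs with hx
  · rw [mul_zero]
    refine Finset.sum_eq_zero fun u _ => ?_
    rw [if_neg (by rw [hx]; exact u.ne_zero)]
  · rw [Finset.sum_eq_single (Units.mk0 x hx)]
    · simp
    · intro u _ hu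
      rw [if_neg]
      intro h
      exact hu (Units.ext h)
    · simp

theorem sum_zmod_val {M : Type*} [AddCommMonoid M] (f : ℕ → M) :
    ∑ b : ZMod p, f b.val = ∑ j ∈ Finset.range p, f j :=
  Finset.sum_bij' (fun b _ => b.val) (fun j _ => (j : ZMod p))
    (fun b _ => Finset.mem_range.2 (ZMod.val_lt b)) (fun _ _ => Finset.mem_univ _)
    (fun b _ => ZMod.natCast_zmod_val b)
    (fun _ hj => ZMod.val_cast_of_lt (Finset.mem_range.1 hj)) (fun _ _ => rfl)

theorem norm_sum_expChar_mul_invChar_le {c : ZMod p} (hc : c ≠ 0) (θ : ℝ) (m : ℕ) {n : ℕ}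
    (hn : n ≤ p) :
    ‖∑ u ∈ Finset.Ico m n, expChar (θ * u) * invChar p c u‖ ≤
      6.5 * (p : ℝ) ^ (3 / 4 : ℝ) := by
  have hp : (0 : ℝ) < p := by exact_mod_cast (Fact.out : p.Prime).pos
  set k : ℤ := ⌊θ * p⌋ with hk
  set η : ℝ := Int.fract (θ * p) with hη
  have hθ : θ = (k + η) / p := by
    rw [hk, hη, Int.floor_add_fract]; field_simp
  set G : ZMod p → ℂ := fun a =>
    ∑ u ∈ Finset.Ico m n, expChar (θ * u) * ZMod.stdAddChar (N := p) (-(a * u)) with hG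
  set w : ℕ → ℝ := fun j => 1 / (min (j : ℝ) ((p : ℝ) - 1 - j) + 1) with hw
  have hGle : ∀ b : ZMod p, ‖G (k - b)‖ ≤ p * w b.val := by
    intro b
    have e : G (k - b) = ∑ u ∈ Finset.Ico m n, expChar ((η + b.val) / p * u) := by
      refine Finset.sum_congr rfl fun u _ => ?_
      have e1 : -(((k : ZMod p) - b) * u) = (((b.val - k) * u : ℤ) : ZMod p) := by
        push_cast
        rw [ZMod.natCast_zmod_val]
        ring
      rw [e1, stdAddChar_intCast_eq_expChar, ← expChar_add, hθ]
      congr 1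
      push_cast
      ring
    rw [e]
    exact norm_sum_expChar_shift_le hn (ZMod.val_lt b) (Int.fract_nonneg _) (Int.fract_lt_one _)
  have hmain : (p : ℂ) * ∑ u ∈ Finset.Ico m n, expChar (θ * u) * invChar p c u =
      ∑ a : ZMod p, kloostermanSum p a c * G a := by
    simp_rw [hG, Finset.mul_sum]
    rw [Finset.sum_comm]
    refine Finset.sum_congr rfl fun u _ => ?_
    rw [mul_left_comm, ← sum_kloostermanSum_mul, Finset.mul_sum]
    refine Finset.sum_congr rfl fun a _ => ?_
    ring
  have hw0 : ∀ b : ZMod p, 0 ≤ w b.val := by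
    intro b
    have : (b.val : ℝ) + 1 ≤ p := by exact_mod_cast ZMod.val_lt b
    have : (0 : ℝ) ≤ min (b.val : ℝ) ((p : ℝ) - 1 - b.val) :=
      le_min (by positivity) (by linarith)
    positivity
  have hhold := Real.inner_le_Lp_mul_Lq (Finset.univ : Finset (ZMod p))
    (fun b => ‖kloostermanSum p (k - b) c‖) (fun b => w b.val) (p := 4) (q := 4 / 3)
    (by constructor <;> norm_num)
  have hK : ∑ b : ZMod p, |‖kloostermanSum p (k - b) c‖| ^ (4 : ℝ) ≤ 3 * (p : ℝ) ^ 3 := by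
    rw [← Equiv.sum_comp (Equiv.subLeft (k : ZMod p))]
    refine le_trans (le_of_eq ?_) (sum_norm_kloostermanSum_pow_four_le p hc)
    refine Finset.sum_congr rfl fun a _ => ?_
    rw [abs_norm, ← Real.rpow_natCast]
    simp
  have hW : ∑ b : ZMod p, |w b.val| ^ (4 / 3 : ℝ) ≤ 8 := by
    simp_rw [abs_of_nonneg (hw0 _)]
    rw [sum_zmod_val p (fun j => w j ^ (4 / 3 : ℝ))]
    exact sum_inv_min_add_one_rpow_le p
  have hfin : (3 * (p : ℝ) ^ 3) ^ (1 / 4 : ℝ) * 8 ^ (1 / (4 / 3) : ℝ) ≤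
      6.5 * (p : ℝ) ^ (3 / 4 : ℝ) := by
    have e1 : (3 * (p : ℝ) ^ 3) ^ (1 / 4 : ℝ) = 3 ^ (1 / 4 : ℝ) * (p : ℝ) ^ (3 / 4 : ℝ) := by
      rw [Real.mul_rpow (by norm_num) (by positivity), ← Real.rpow_natCast, ← Real.rpow_mul hp.le]
      norm_num
    have e2 : (3 : ℝ) ^ (1 / 4 : ℝ) * 8 ^ (1 / (4 / 3) : ℝ) ≤ 6.5 := by
      have : (8 : ℝ) ^ (1 / (4 / 3) : ℝ) = 512 ^ (1 / 4 : ℝ) := by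
        rw [show (512 : ℝ) = 8 ^ (3 : ℝ) by norm_num, ← Real.rpow_mul (by norm_num)]
        norm_num
      rw [this, ← Real.mul_rpow (by norm_num) (by norm_num)]
      calc ((3 : ℝ) * 512) ^ (1 / 4 : ℝ) ≤ (6.5 ^ (4 : ℝ)) ^ (1 / 4 : ℝ) := by
            apply Real.rpow_le_rpow <;> norm_num
        _ = 6.5 := by rw [← Real.rpow_mul (by norm_num)]; norm_num
    rw [e1]
    have : 0 ≤ (p : ℝ) ^ (3 / 4 : ℝ) := by positivity
    nlinarith
  have hnorm : (p : ℝ) * ‖∑ u ∈ Finset.Ico m n, expChar (θ * u) * invChar p c u‖ ≤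
      p * (6.5 * (p : ℝ) ^ (3 / 4 : ℝ)) := by
    calc (p : ℝ) * ‖∑ u ∈ Finset.Ico m n, expChar (θ * u) * invChar p c u‖
        = ‖∑ a : ZMod p, kloostermanSum p a c * G a‖ := by
          rw [← hmain, norm_mul, Complex.norm_natCast]
      _ = ‖∑ b : ZMod p, kloostermanSum p (k - b) c * G (k - b)‖ := by
          rw [← Equiv.sum_comp (Equiv.subLeft (k : ZMod p))]; rfl
      _ ≤ ∑ b : ZMod p, p * (‖kloostermanSum p (k - b) c‖ * w b.val) := by
          refine (norm_sum_le _ _).trans (Finset.sum_le_sum fun b _ => ?_)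
          rw [norm_mul, mul_left_comm]
          gcongr
          exact hGle b
      _ ≤ p * ((3 * (p : ℝ) ^ 3) ^ (1 / 4 : ℝ) * 8 ^ (1 / (4 / 3) : ℝ)) := by
          rw [← Finset.mul_sum]
          gcongr
          refine hhold.trans ?_
          gcongr
      _ ≤ _ := by gcongr
  exact le_of_mul_le_mul_left hnorm hp

end IncompleteSums

theorem hasSum_cos_div_sq (t : ℝ) :
    HasSum (fun n : ℕ => 1 / (n : ℝ) ^ 2 * Real.cos (2 * Real.pi * n * t))
      (Real.pi ^ 2 * (Int.fract t ^ 2 - Int.fract t + 1 / 6)) := by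
  have h := hasSum_one_div_nat_pow_mul_cos (k := 1) one_ne_zero (x := Int.fract t)
    ⟨Int.fract_nonneg t, (Int.fract_lt_one t).le⟩
  have hb : (Polynomial.map (algebraMap ℚ ℝ) (Polynomial.bernoulli (2 * 1))).eval (Int.fract t) =
      Int.fract t ^ 2 - Int.fract t + 1 / 6 := by
    simp [Polynomial.bernoulli, Finset.sum_range_succ, bernoulli]
    ring
  rw [hb] at h
  convert h using 2 with n
  · rw [mul_one]
    congr 1
    have : 2 * Real.pi * n * t = 2 * Real.pi * n * Int.fract t +
        ((n * ⌊t⌋ : ℤ) : ℝ) * (2 * Real.pi) := by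
      nth_rewrite 1 [← Int.floor_add_fract t]
      push_cast
      ring
    rw [this, Real.cos_add_int_mul_two_pi]
  · norm_num
    ring

/-- The sawtooth function `{t} - 1/2`. -/
noncomputable def sawtooth (t : ℝ) : ℝ := Int.fract t - 1 / 2

/-- A periodic antiderivative of the sawtooth function. -/
noncomputable def sawtoothPrimitive (t : ℝ) : ℝ := (Int.fract t ^ 2 - Int.fract t) / 2

theorem sawtoothPrimitive_add_sub_le (t : ℝ) {δ : ℝ} (h0 : 0 ≤ δ) (h1 : δ < 1) :
    sawtoothPrimitive (t + δ) - sawtoothPrimitive t ≤ δ * sawtooth t + δ ^ 2 / 2 := by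
  have hf0 := Int.fract_nonneg t
  have hf1 := Int.fract_lt_one t
  have ht := Int.floor_add_fract t
  unfold sawtoothPrimitive sawtooth
  rcases lt_or_ge (Int.fract t + δ) 1 with h | h
  · have : Int.fract (t + δ) = Int.fract t + δ := by
      rw [Int.fract_eq_iff]
      exact ⟨by linarith, h, ⌊t⌋, by linarith⟩
    rw [this]; nlinarith
  · have : Int.fract (t + δ) = Int.fract t + δ - 1 := by
      rw [Int.fract_eq_iff]
      exact ⟨by linarith, by linarith, ⌊t⌋ + 1, by push_cast; linarith⟩
    rw [this]; nlinarith

theorem le_sawtoothPrimitive_sub_sub (t : ℝ) {δ : ℝ} (h0 : 0 ≤ δ) (h1 : δ < 1) :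
    δ * sawtooth t - δ ^ 2 / 2 ≤ sawtoothPrimitive t - sawtoothPrimitive (t + -δ) := by
  have hf0 := Int.fract_nonneg t
  have hf1 := Int.fract_lt_one t
  have ht := Int.floor_add_fract t
  unfold sawtoothPrimitive sawtooth
  rcases le_or_gt δ (Int.fract t) with h | h
  · have : Int.fract (t + -δ) = Int.fract t - δ := by
      rw [Int.fract_eq_iff]
      exact ⟨by linarith, by linarith, ⌊t⌋, by linarith⟩
    rw [this]; nlinarith
  · have : Int.fract (t + -δ) = Int.fract t - δ + 1 := by
      rw [Int.fract_eq_iff]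
      exact ⟨by linarith, by linarith, ⌊t⌋ - 1, by push_cast; linarith⟩
    rw [this]; nlinarith

theorem sum_range_inv_le_one_add_log {p : ℕ} (hp : 0 < p) :
    ∑ n ∈ Finset.range p, 1 / (n : ℝ) ≤ 1 + Real.log p := by
  obtain ⟨q, rfl⟩ : ∃ q, p = q + 1 := ⟨p - 1, by omega⟩
  rw [Finset.sum_range_succ']
  have h := harmonic_le_one_add_log q
  have e : ((harmonic q : ℚ) : ℝ) = ∑ i ∈ Finset.range q, 1 / ((i + 1 : ℕ) : ℝ) := by
    rw [harmonic]; push_cast; simp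
  rw [← e]
  have : Real.log q ≤ Real.log ((q + 1 : ℕ) : ℝ) := by
    rcases Nat.eq_zero_or_pos q with rfl | hq
    · simp
    · apply Real.log_le_log <;> [exact_mod_cast hq; exact_mod_cast Nat.le_succ q]
  simp only [Nat.cast_zero, div_zero, add_zero]
  linarith

theorem sum_Ico_inv_sq_le {p : ℕ} (hp : 0 < p) (N : ℕ) :
    ∑ n ∈ Finset.Ico p N, 1 / (n : ℝ) ^ 2 ≤ 2 / (p : ℝ) := by
  obtain ⟨q, rfl⟩ : ∃ q, p = q + 1 := ⟨p - 1, by omega⟩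
  have h := sum_Ioo_inv_sq_le (α := ℝ) q N
  have e : Finset.Ico (q + 1) N = Finset.Ioo q N := by
    ext x; simp
  rw [e]
  simpa only [one_div, Nat.cast_add, Nat.cast_one] using h

theorem abs_sum_cos_sub_cos_le {ι : Type*} (s : Finset ι) (g : ι → ℝ) (n : ℕ) (σ : ℝ) :
    |∑ i ∈ s, (Real.cos (2 * Real.pi * n * (g i + σ)) - Real.cos (2 * Real.pi * n * g i))| ≤
      ‖expChar (n * σ) - 1‖ * ‖∑ i ∈ s, expChar (n * g i)‖ := by
  have hre : ∀ x : ℝ, Real.cos (2 * Real.pi * n * x) = (expChar (n * x)).re := by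
    intro x
    rw [expChar, Complex.exp_ofReal_mul_I_re]
    congr 1; ring
  have : ∑ i ∈ s, (Real.cos (2 * Real.pi * n * (g i + σ)) - Real.cos (2 * Real.pi * n * g i)) =
      ((expChar (n * σ) - 1) * ∑ i ∈ s, expChar (n * g i)).re := by
    rw [Finset.mul_sum, Complex.re_sum]
    refine Finset.sum_congr rfl fun i _ => ?_
    rw [hre, hre, mul_add, expChar_add, ← Complex.sub_re]
    congr 1; ring
  rw [this, ← norm_mul]
  exact Complex.abs_re_le_norm _

theorem abs_sum_sawtoothPrimitive_sub_le {ι : Type*} (s : Finset ι) (g : ι → ℝ) {p : ℕ}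
    (hp : 0 < p) (hs : s.card ≤ p) {M : ℝ} (hM : 0 ≤ M)
    (hE : ∀ n : ℕ, 0 < n → n < p → ‖∑ i ∈ s, expChar (n * g i)‖ ≤ M) (σ : ℝ) :
    |∑ i ∈ s, (sawtoothPrimitive (g i + σ) - sawtoothPrimitive (g i))| ≤
      (2 * Real.pi * |σ| * M * (1 + Real.log p) + 4) / (2 * Real.pi ^ 2) := by
  have hpi := Real.pi_pos
  have hsum : HasSum (fun n : ℕ => 1 / (n : ℝ) ^ 2 *
      ∑ i ∈ s, (Real.cos (2 * Real.pi * n * (g i + σ)) - Real.cos (2 * Real.pi * n * g i)))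
      (2 * Real.pi ^ 2 * ∑ i ∈ s, (sawtoothPrimitive (g i + σ) - sawtoothPrimitive (g i))) := by
    simp_rw [Finset.mul_sum]
    refine hasSum_sum fun i _ => ?_
    have h := (hasSum_cos_div_sq (g i + σ)).sub (hasSum_cos_div_sq (g i))
    simp_rw [← mul_sub] at h
    rwa [show 2 * Real.pi ^ 2 * (sawtoothPrimitive (g i + σ) - sawtoothPrimitive (g i)) =
      Real.pi ^ 2 * (Int.fract (g i + σ) ^ 2 - Int.fract (g i + σ) + 1 / 6 -
        (Int.fract (g i) ^ 2 - Int.fract (g i) + 1 / 6)) by unfold sawtoothPrimitive; ring]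
  have hterm : ∀ n : ℕ, |1 / (n : ℝ) ^ 2 *
      ∑ i ∈ s, (Real.cos (2 * Real.pi * n * (g i + σ)) - Real.cos (2 * Real.pi * n * g i))| ≤
      1 / (n : ℝ) ^ 2 * (‖expChar (n * σ) - 1‖ * ‖∑ i ∈ s, expChar (n * g i)‖) := by
    intro n
    rw [abs_mul, abs_of_nonneg (by positivity : (0 : ℝ) ≤ 1 / (n : ℝ) ^ 2)]
    gcongr
    exact abs_sum_cos_sub_cos_le s g n σ
  have hsmall : ∀ n ∈ Finset.range p, |1 / (n : ℝ) ^ 2 *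
      ∑ i ∈ s, (Real.cos (2 * Real.pi * n * (g i + σ)) - Real.cos (2 * Real.pi * n * g i))| ≤
      2 * Real.pi * |σ| * M * (1 / (n : ℝ)) := by
    intro n hn
    refine (hterm n).trans ?_
    rcases Nat.eq_zero_or_pos n with rfl | hn0
    · simp
    have hn' : (0 : ℝ) < n := by exact_mod_cast hn0
    have h1 := norm_expChar_sub_one_le (n * σ)
    rw [abs_mul, abs_of_pos hn'] at h1
    calc _ ≤ 1 / (n : ℝ) ^ 2 * ((2 * Real.pi * (n * |σ|)) * M) := by
          gcongr
          exact hE n hn0 (Finset.mem_range.1 hn)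
      _ = _ := by field_simp
  have hlarge : ∀ n : ℕ, |1 / (n : ℝ) ^ 2 *
      ∑ i ∈ s, (Real.cos (2 * Real.pi * n * (g i + σ)) - Real.cos (2 * Real.pi * n * g i))| ≤
      2 * p * (1 / (n : ℝ) ^ 2) := by
    intro n
    refine (hterm n).trans ?_
    rw [mul_comm]
    gcongr
    · refine (norm_sub_le _ _).trans ?_
      rw [norm_expChar, norm_one]; norm_num
    · refine (norm_sum_le _ _).trans ?_
      simp only [norm_expChar, Finset.sum_const, nsmul_eq_mul, mul_one]
      exact_mod_cast hs
  have hlim := hsum.tendsto_sum_nat.abs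
  have hbound : |2 * Real.pi ^ 2 *
      ∑ i ∈ s, (sawtoothPrimitive (g i + σ) - sawtoothPrimitive (g i))| ≤
      2 * Real.pi * |σ| * M * (1 + Real.log p) + 4 := by
    refine le_of_tendsto hlim ?_
    filter_upwards [Filter.eventually_ge_atTop p] with N hN
    rw [← Finset.sum_range_add_sum_Ico _ hN]
    refine (abs_add_le _ _).trans (add_le_add ?_ ?_)
    · refine (Finset.abs_sum_le_sum_abs _ _).trans ((Finset.sum_le_sum hsmall).trans ?_)
      rw [← Finset.mul_sum]
      gcongr
      exact sum_range_inv_le_one_add_log hp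
    · refine (Finset.abs_sum_le_sum_abs _ _).trans
        ((Finset.sum_le_sum fun n _ => hlarge n).trans ?_)
      rw [← Finset.mul_sum]
      have hp' : (0 : ℝ) < p := by exact_mod_cast hp
      calc 2 * (p : ℝ) * ∑ n ∈ Finset.Ico p N, 1 / (n : ℝ) ^ 2 ≤ 2 * p * (2 / p) := by
            gcongr
            exact sum_Ico_inv_sq_le hp N
        _ = 4 := by field_simp; norm_num
  rw [abs_mul, abs_of_pos (by positivity)] at hbound
  rw [le_div_iff₀ (by positivity)]
  linarith

theorem abs_sum_sawtooth_le {ι : Type*} (s : Finset ι) (g : ι → ℝ) {p : ℕ}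
    (hp : 0 < p) (hs : s.card ≤ p) {M : ℝ} (hM : 0 ≤ M)
    (hE : ∀ n : ℕ, 0 < n → n < p → ‖∑ i ∈ s, expChar (n * g i)‖ ≤ M) {δ : ℝ}
    (h0 : 0 < δ) (h1 : δ < 1) :
    |∑ i ∈ s, sawtooth (g i)| ≤
      M * (1 + Real.log p) / Real.pi + 2 / (Real.pi ^ 2 * δ) + δ * p / 2 := by
  have hpi := Real.pi_pos
  have hs' : (s.card : ℝ) ≤ p := by exact_mod_cast hs
  have hA := abs_sum_sawtoothPrimitive_sub_le s g hp hs hM hE δ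
  have hB := abs_sum_sawtoothPrimitive_sub_le s g hp hs hM hE (-δ)
  rw [abs_neg] at hB
  rw [abs_of_pos h0] at hA hB
  have hlow : ∑ i ∈ s, (sawtoothPrimitive (g i + δ) - sawtoothPrimitive (g i)) ≤
      δ * ∑ i ∈ s, sawtooth (g i) + s.card * (δ ^ 2 / 2) := by
    rw [Finset.mul_sum, ← nsmul_eq_mul, ← Finset.sum_const, ← Finset.sum_add_distrib]
    exact Finset.sum_le_sum fun i _ => sawtoothPrimitive_add_sub_le _ h0.le h1
  have hup : δ * ∑ i ∈ s, sawtooth (g i) - s.card * (δ ^ 2 / 2) ≤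
      -∑ i ∈ s, (sawtoothPrimitive (g i + -δ) - sawtoothPrimitive (g i)) := by
    rw [Finset.mul_sum, ← nsmul_eq_mul, ← Finset.sum_const, ← Finset.sum_sub_distrib,
      ← Finset.sum_neg_distrib]
    refine Finset.sum_le_sum fun i _ => ?_
    linarith [le_sawtoothPrimitive_sub_sub (g i) h0.le h1]
  have hc : s.card * (δ ^ 2 / 2) ≤ p * (δ ^ 2 / 2) := by gcongr
  have e : M * (1 + Real.log p) / Real.pi + 2 / (Real.pi ^ 2 * δ) + δ * p / 2 =
      ((2 * Real.pi * δ * M * (1 + Real.log p) + 4) / (2 * Real.pi ^ 2) + p * (δ ^ 2 / 2)) / δ := by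
    field_simp
    ring
  rw [e, le_div_iff₀ h0]
  have hA' := abs_le.1 hA
  have hB' := abs_le.1 hB
  have : |∑ i ∈ s, sawtooth (g i)| * δ = |δ * ∑ i ∈ s, sawtooth (g i)| := by
    rw [abs_mul, abs_of_pos h0, mul_comm]
  rw [this, abs_le]
  constructor <;> linarith [hA'.1, hB'.1]
section SawtoothInverse

variable (p : ℕ) [Fact p.Prime]

theorem norm_sum_expChar_add_inv_le {c : ℤ} (hc : (c : ZMod p) ≠ 0) (θ : ℝ) (m : ℕ) {n : ℕ}
    (hn : n ≤ p) :
    ‖∑ u ∈ Finset.Ico m n, expChar (θ * u + c * ((u : ZMod p)⁻¹.val : ℝ) / p)‖ ≤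
      6.5 * (p : ℝ) ^ (3 / 4 : ℝ) + 1 := by
  have h : ∀ u ∈ Finset.Ico m n, expChar (θ * u + c * ((u : ZMod p)⁻¹.val : ℝ) / p) =
      expChar (θ * u) * invChar p c u + if u = 0 then 1 else 0 := by
    intro u hu
    rcases Nat.eq_zero_or_pos u with rfl | hu0
    · simp [invChar, expChar]
    · have hu1 : (u : ZMod p) ≠ 0 := by
        rw [Ne, ZMod.natCast_eq_zero_iff]
        exact Nat.not_dvd_of_pos_of_lt hu0 (by rw [Finset.mem_Ico] at hu; omega)
      have e : (c : ZMod p) * (u : ZMod p)⁻¹ = ((c * ((u : ZMod p)⁻¹.val : ℤ) : ℤ) : ZMod p) := by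
        push_cast
        rw [ZMod.natCast_zmod_val]
      rw [invChar, if_neg hu1, if_neg hu0.ne', add_zero, e, stdAddChar_intCast_eq_expChar,
        ← expChar_add]
      push_cast
      rfl
  rw [Finset.sum_congr rfl h, Finset.sum_add_distrib]
  refine (norm_add_le _ _).trans (add_le_add (norm_sum_expChar_mul_invChar_le p hc θ m hn) ?_)
  rw [Finset.sum_ite_eq']
  split_ifs <;> simp

theorem abs_sum_sawtooth_add_inv_le (hp : 100 ≤ p) {ε : ℤ} (hε : ε = 1 ∨ ε = -1) (α β : ℝ)
    (m : ℕ) {n : ℕ} (hn : n ≤ p) :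
    |∑ u ∈ Finset.Ico m n, sawtooth (α * u + β + ε * ((u : ZMod p)⁻¹.val : ℝ) / p)| ≤
      3 * (p : ℝ) ^ (3 / 4 : ℝ) * Real.log p := by
  have hp' : (100 : ℝ) ≤ p := by exact_mod_cast hp
  have hp0 : (0 : ℝ) < p := by linarith
  have hpi := Real.pi_gt_d2
  set P := (p : ℝ) ^ (3 / 4 : ℝ) with hP
  set L := Real.log p with hL
  have hL4 : 4 ≤ L := by
    rw [hL, Real.le_log_iff_exp_le hp0]
    have : Real.exp 4 = Real.exp 1 ^ 4 := by rw [← Real.exp_nat_mul]; norm_num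
    rw [this]
    calc (Real.exp 1 ^ 4 : ℝ) ≤ (3 : ℝ) ^ 4 := by
          gcongr
          exact Real.exp_one_lt_three.le
      _ ≤ p := by linarith
  have hPsq : p ≤ P ^ 2 := by
    rw [hP, ← Real.rpow_natCast, ← Real.rpow_mul hp0.le]
    calc (p : ℝ) = (p : ℝ) ^ (1 : ℝ) := (Real.rpow_one _).symm
      _ ≤ _ := Real.rpow_le_rpow_of_exponent_le (by linarith) (by norm_num)
  have hP0 : 0 < P := by positivity
  have hP10 : 10 ≤ P := by nlinarith
  have h := abs_sum_sawtooth_le (Finset.Ico m n)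
    (fun u => α * u + β + ε * ((u : ZMod p)⁻¹.val : ℝ) / p) (p := p) (by omega)
    (by rw [Nat.card_Ico]; omega) (M := 6.5 * P + 1) (by positivity) ?_
    (δ := 1 / P) (by positivity) (by rw [div_lt_one hP0]; linarith)
  · refine h.trans ?_
    have hpi0 := Real.pi_pos
    have h1 : (6.5 * P + 1) * (1 + L) / Real.pi ≤ 6.6 * P * (1.25 * L) / 3.14 := by
      gcongr <;> linarith
    have h2 : 2 / (Real.pi ^ 2 * (1 / P)) ≤ 0.06 * P * L := by
      have : 2 / (Real.pi ^ 2 * (1 / P)) = 2 * P / Real.pi ^ 2 := by field_simp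
      rw [this, div_le_iff₀ (by positivity)]
      have h9 : (9.8 : ℝ) ≤ Real.pi ^ 2 := by nlinarith
      have : 0.06 * P * 4 * 9.8 ≤ 0.06 * P * L * Real.pi ^ 2 := by gcongr
      linarith
    have h3 : 1 / P * p / 2 ≤ 0.125 * P * L := by
      have : 1 / P * p / 2 = p / (2 * P) := by field_simp
      rw [this, div_le_iff₀ (by positivity)]
      nlinarith [mul_le_mul_of_nonneg_left hL4 (sq_nonneg P)]
    have hPL : 0 < P * L := by positivity
    have h4 : 6.6 * P * (1.25 * L) / 3.14 ≤ 2.65 * (P * L) := by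
      rw [div_le_iff₀ (by norm_num)]; nlinarith
    nlinarith
  · intro k hk0 hkp
    have hk : ((k * ε : ℤ) : ZMod p) ≠ 0 := by
      have hk1 : (k : ZMod p) ≠ 0 := by
        rw [Ne, ZMod.natCast_eq_zero_iff]
        exact Nat.not_dvd_of_pos_of_lt hk0 hkp
      rcases hε with rfl | rfl <;> simpa using hk1
    have e : ∑ u ∈ Finset.Ico m n, expChar (k * (α * u + β + ε * ((u : ZMod p)⁻¹.val : ℝ) / p)) =
        expChar (k * β) * ∑ u ∈ Finset.Ico m n,
          expChar ((k * α) * u + ((k * ε : ℤ) : ℝ) * ((u : ZMod p)⁻¹.val : ℝ) / p) := by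
      rw [Finset.mul_sum]
      refine Finset.sum_congr rfl fun u _ => ?_
      rw [← expChar_add]
      congr 1
      push_cast
      ring
    rw [e, norm_mul, norm_expChar, one_mul]
    exact norm_sum_expChar_add_inv_le p hk _ m hn

end SawtoothInverse

theorem ite_le_le_eq_sawtooth {P l h y : ℝ} (hP : 0 < P) (hl : 0 ≤ l) (hlh : l ≤ h) (hh : h < P)
    (hy0 : 0 ≤ y) (hy : y < P) :
    (if l ≤ y ∧ y ≤ h then 1 else 0 : ℝ) =
      (h - l) / P - sawtooth ((h - y) / P) - sawtooth ((y - l) / P) := by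
  have key : ∀ s t : ℝ, 0 ≤ s → s < P → 0 ≤ t → t < P →
      Int.fract ((s - t) / P) = (s - t) / P + if t ≤ s then 0 else 1 := by
    intro s t hs0 hs ht0 ht
    split_ifs with hts
    · rw [add_zero, Int.fract_eq_self]
      exact ⟨div_nonneg (by linarith) hP.le, by rw [div_lt_one hP]; linarith⟩
    · rw [Int.fract_eq_iff]
      push Not at hts
      refine ⟨?_, ?_, -1, by push_cast; ring⟩
      · have : -1 ≤ (s - t) / P := by rw [le_div_iff₀ hP]; linarith
        linarith
      · have : (s - t) / P < 0 := div_neg_of_neg_of_pos (by linarith) hP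
        linarith
  unfold sawtooth
  rw [key h y (by linarith) hh hy0 hy, key y l hy0 hy hl (by linarith)]
  have e : (h - y) / P + (y - l) / P = (h - l) / P := by ring
  split_ifs with h1 h2 h3 h4 h5 h6 <;> first | linarith | (exfalso; simp_all)

section Counting

variable (p : ℕ) [Fact p.Prime]

theorem mul_modEq_one_iff_eq_inv_val {x y : ℕ} (hx0 : 0 < x) (hx : x < p) (hy : y < p) :
    x * y ≡ 1 [MOD p] ↔ y = (x : ZMod p)⁻¹.val := by
  have hx1 : (x : ZMod p) ≠ 0 := by
    rw [Ne, ZMod.natCast_eq_zero_iff]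
    exact Nat.not_dvd_of_pos_of_lt hx0 hx
  rw [← ZMod.natCast_eq_natCast_iff]
  push_cast
  constructor
  · intro h
    rw [← eq_inv_of_mul_eq_one_right h, ZMod.val_cast_of_lt hy]
  · intro h
    rw [h, ZMod.natCast_zmod_val, mul_inv_cancel₀ hx1]

theorem setOf_invCount_eq_image {S : Set (ℝ × ℝ)}
    (hS : S ⊆ Set.Icc ((0 : ℝ), (0 : ℝ)) (((p : ℝ) - 1), ((p : ℝ) - 1))) :
    {xy : ℕ × ℕ | 0 < xy.1 ∧ 0 < xy.2 ∧ ((xy.1 : ℝ), (xy.2 : ℝ)) ∈ S ∧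
      xy.1 * xy.2 ≡ 1 [MOD p]} =
    (fun u : ℕ => (u, (u : ZMod p)⁻¹.val)) ''
      {u : ℕ | 0 < u ∧ ((u : ℝ), ((u : ZMod p)⁻¹.val : ℝ)) ∈ S} := by
  have hlt : ∀ z : ℕ, (z : ℝ) ≤ (p : ℝ) - 1 → z < p := by
    intro z hz
    have : (z : ℝ) < p := by linarith
    exact_mod_cast this
  ext ⟨x, y⟩
  simp only [Set.mem_ofPred_eq, Set.mem_image, Prod.mk.injEq]
  constructor
  · rintro ⟨hx0, hy0, hmem, hmod⟩
    obtain ⟨_, hb⟩ := hS hmem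
    have hy := (mul_modEq_one_iff_eq_inv_val p hx0 (hlt x hb.1) (hlt y hb.2)).1 hmod
    exact ⟨x, ⟨hx0, hy ▸ hmem⟩, rfl, hy.symm⟩
  · rintro ⟨u, ⟨hu0, hmem⟩, rfl, rfl⟩
    obtain ⟨_, hb⟩ := hS hmem
    refine ⟨hu0, ?_, hmem, (mul_modEq_one_iff_eq_inv_val p hu0 (hlt u hb.1) (hlt _ hb.2)).2 rfl⟩
    rw [Nat.pos_iff_ne_zero, Ne, ZMod.val_eq_zero, inv_eq_zero, ZMod.natCast_eq_zero_iff]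
    exact Nat.not_dvd_of_pos_of_lt hu0 (hlt u hb.1)

theorem invCount_eq_ncard {S : Set (ℝ × ℝ)}
    (hS : S ⊆ Set.Icc ((0 : ℝ), (0 : ℝ)) (((p : ℝ) - 1), ((p : ℝ) - 1))) :
    invCount p S = {u : ℕ | 0 < u ∧ ((u : ℝ), ((u : ZMod p)⁻¹.val : ℝ)) ∈ S}.ncard := by
  rw [invCount, setOf_invCount_eq_image p hS, Set.ncard_image_of_injective]
  intro u v h
  exact (Prod.mk.inj h).1

theorem invCount_le {S : Set (ℝ × ℝ)}
    (hS : S ⊆ Set.Icc ((0 : ℝ), (0 : ℝ)) (((p : ℝ) - 1), ((p : ℝ) - 1))) :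
    invCount p S ≤ p := by
  rw [invCount_eq_ncard p hS]
  calc _ ≤ (Finset.range p : Set ℕ).ncard := by
        refine Set.ncard_le_ncard ?_ (Finset.finite_toSet _)
        rintro u ⟨_, hmem⟩
        obtain ⟨_, hb⟩ := hS hmem
        have h1 : (u : ℝ) ≤ (p : ℝ) - 1 := hb.1
        have : (u : ℝ) < p := by linarith
        rw [Finset.mem_coe, Finset.mem_range]
        exact_mod_cast this
    _ = p := by rw [Set.ncard_coe_finset, Finset.card_range]

theorem invCount_le_one {S : Set (ℝ × ℝ)} {a : ℝ} (hSa : ∀ z ∈ S, z.1 = a)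
    (hS : S ⊆ Set.Icc ((0 : ℝ), (0 : ℝ)) (((p : ℝ) - 1), ((p : ℝ) - 1))) :
    invCount p S ≤ 1 := by
  rw [invCount_eq_ncard p hS]
  refine (Set.ncard_le_one (Set.Finite.subset (Set.finite_singleton ⌊a⌋₊) ?_)).2 ?_
  · rintro u ⟨_, hmem⟩
    rw [Set.mem_singleton_iff, ← hSa _ hmem]
    simp
  · rintro u ⟨_, hu⟩ v ⟨_, hv⟩
    have : (u : ℝ) = v := (hSa _ hu).trans (hSa _ hv).symm
    exact_mod_cast this

theorem abs_invCount_sub_le {S : Set (ℝ × ℝ)}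
    (hS : S ⊆ Set.Icc ((0 : ℝ), (0 : ℝ)) (((p : ℝ) - 1), ((p : ℝ) - 1)))
    {a c : ℝ} (ha : 0 ≤ a) (hac : a ≤ c) {l h : ℝ → ℝ}
    (hmem : ∀ x y, (x, y) ∈ S ↔ (a ≤ x ∧ x ≤ c) ∧ l x ≤ y ∧ y ≤ h x)
    (hlh : ∀ x, a ≤ x → x ≤ c → l x ≤ h x) :
    |(invCount p S : ℝ) - (∑ u ∈ Finset.Ico ⌈a⌉₊ (⌊c⌋₊ + 1), (h u - l u) / p -
      ∑ u ∈ Finset.Ico ⌈a⌉₊ (⌊c⌋₊ + 1), sawtooth ((h u - ((u : ZMod p)⁻¹.val : ℝ)) / p) -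
      ∑ u ∈ Finset.Ico ⌈a⌉₊ (⌊c⌋₊ + 1), sawtooth ((((u : ZMod p)⁻¹.val : ℝ) - l u) / p))| ≤ 1 := by
  classical
  have hp : (0 : ℝ) < p := by exact_mod_cast (Fact.out : p.Prime).pos
  set J := Finset.Ico ⌈a⌉₊ (⌊c⌋₊ + 1) with hJ
  have hJmem : ∀ u : ℕ, u ∈ J ↔ a ≤ u ∧ (u : ℝ) ≤ c := by
    intro u
    rw [hJ, Finset.mem_Ico, Nat.ceil_le, Nat.lt_add_one_iff, Nat.le_floor_iff (ha.trans hac)]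
  have hset : {u : ℕ | 0 < u ∧ ((u : ℝ), ((u : ZMod p)⁻¹.val : ℝ)) ∈ S} =
      ({u ∈ J | 0 < u ∧ l u ≤ ((u : ZMod p)⁻¹.val : ℝ) ∧ ((u : ZMod p)⁻¹.val : ℝ) ≤ h u} :
        Finset ℕ) := by
    ext u
    simp only [Set.mem_ofPred_eq, Finset.coe_filter, hmem, hJmem]
    tauto
  have hind : ∀ u ∈ J, (if l u ≤ ((u : ZMod p)⁻¹.val : ℝ) ∧ ((u : ZMod p)⁻¹.val : ℝ) ≤ h u
      then 1 else 0 : ℝ) = (h u - l u) / p - sawtooth ((h u - ((u : ZMod p)⁻¹.val : ℝ)) / p) -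
        sawtooth ((((u : ZMod p)⁻¹.val : ℝ) - l u) / p) := by
    intro u hu
    have hu' := (hJmem u).1 hu
    have h1 := hlh u hu'.1 hu'.2
    obtain ⟨hb1, -⟩ := hS ((hmem u (l u)).2 ⟨hu', le_rfl, h1⟩)
    obtain ⟨-, hb2⟩ := hS ((hmem u (h u)).2 ⟨hu', h1, le_rfl⟩)
    have h2 : (0 : ℝ) ≤ l u := hb1.2
    have h3 : h u ≤ (p : ℝ) - 1 := hb2.2
    exact ite_le_le_eq_sawtooth hp h2 h1 (by linarith) (by positivity)
      (by exact_mod_cast ZMod.val_lt _)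
  rw [← Finset.sum_sub_distrib, ← Finset.sum_sub_distrib, ← Finset.sum_congr rfl hind,
    invCount_eq_ncard p hS, hset, Set.ncard_coe_finset, Finset.card_filter, Nat.cast_sum,
    ← Finset.sum_sub_distrib]
  calc _ ≤ ∑ u ∈ J, if u = 0 then (1 : ℝ) else 0 := by
        refine (Finset.abs_sum_le_sum_abs _ _).trans (Finset.sum_le_sum fun u _ => ?_)
        rcases Nat.eq_zero_or_pos u with h0 | h0
        · simp only [h0, lt_irrefl, false_and, if_false, if_true, Nat.cast_zero, zero_sub, abs_neg]
          split_ifs <;> simp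
        · simp [h0, h0.ne']
    _ ≤ 1 := by
        rw [Finset.sum_ite_eq']
        split_ifs <;> norm_num

end Counting

theorem sum_Ico_affine (s t : ℝ) {m n : ℕ} (hmn : m ≤ n) :
    ∑ u ∈ Finset.Ico m n, (s * u + t) = (n - m) * (s * ((n + m - 1) / 2) + t) := by
  induction n, hmn using Nat.le_induction with
  | base => simp
  | succ k hk ih =>
    rw [Finset.sum_Ico_succ_top hk, ih]
    push_cast
    ring

theorem abs_sum_affine_sub_integral_le {s t a b P : ℝ} {m n : ℕ} (hmn : m ≤ n) (hab : a ≤ b)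
    (hm : a ≤ m) (hm' : m ≤ a + 1) (hn : b ≤ n) (hn' : n ≤ b + 1)
    (ha0 : 0 ≤ s * a + t) (ha : s * a + t ≤ P) (hb0 : 0 ≤ s * b + t) (hb : s * b + t ≤ P) :
    |∑ u ∈ Finset.Ico m n, (s * u + t) - ∫ x in a..b, (s * x + t)| ≤ 2 * P := by
  have h_integral : ∫ x in a..b, (s * x + t) = (b - a) * (s * ((a + b) / 2) + t) := by
    rw [intervalIntegral.integral_add
      (Continuous.intervalIntegrable (by fun_prop) _ _)
      (Continuous.intervalIntegrable (by fun_prop) _ _),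
      intervalIntegral.integral_const_mul, integral_id, intervalIntegral.integral_const,
      smul_eq_mul]
    ring
  rw [h_integral, sum_Ico_affine s t hmn]
  obtain ⟨k, rfl⟩ := Nat.exists_eq_add_of_le hmn
  push_cast at hn hn' ⊢
  set I := s * ((a + b) / 2) + t with hI
  have hI0 : 0 ≤ I := by rw [hI]; linarith
  have hIP : I ≤ P := by rw [hI]; linarith
  have e : (m + k - m : ℝ) * (s * ((m + k + m - 1) / 2) + t) - (b - a) * I =
      (k - (b - a)) * I + k * (s * ((m - a) + (m + k - b) - 1) / 2) := by
    rw [hI]; ring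
  rw [e]
  have h1 : |(k - (b - a)) * I| ≤ P := by
    rw [abs_mul, abs_of_nonneg hI0]
    calc _ ≤ 1 * I := by
          gcongr
          rw [abs_le]
          constructor <;> linarith
      _ ≤ P := by linarith
  have hsw : |s| * (b - a) ≤ P := by
    rw [← abs_of_nonneg (sub_nonneg.2 hab), ← abs_mul, abs_le]
    constructor <;> linarith
  have hk : k * |(m - a) + (m + k - b) - 1| ≤ 2 * (b - a) := by
    have he : |(m - a) + (m + k - b) - 1| ≤ 1 := by
      rw [abs_le]; constructor <;> linarith
    rcases Nat.lt_or_ge k 2 with h | h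
    · interval_cases k
      · simp; linarith
      · push_cast at *
        rw [one_mul, abs_le]; constructor <;> linarith
    · have : (2 : ℝ) ≤ k := by exact_mod_cast h
      nlinarith
  have h2 : |k * (s * ((m - a) + (m + k - b) - 1) / 2)| ≤ P := by
    have : k * (s * ((m - a) + (m + k - b) - 1) / 2) =
        s * (k * ((m - a) + (m + k - b) - 1)) / 2 := by ring
    rw [this, abs_div, abs_mul, abs_mul, abs_of_nonneg (Nat.cast_nonneg (α := ℝ) k), abs_two]
    nlinarith [abs_nonneg s, mul_le_mul_of_nonneg_left hk (abs_nonneg s)]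
  calc _ ≤ _ := abs_add_le _ _
    _ ≤ 2 * P := by linarith

theorem le_floor_add_one {c : ℝ} : c ≤ ((⌊c⌋₊ + 1 : ℕ) : ℝ) := by
  push_cast
  exact (Nat.lt_floor_add_one c).le

theorem ceil_le_floor_add_one {b c : ℝ} (hbc : b ≤ c) : ⌈b⌉₊ ≤ ⌊c⌋₊ + 1 :=
  Nat.ceil_le.2 (hbc.trans le_floor_add_one)

/-- The function equal to `s₁ x + t₁` for `x < b` and to `s₂ x + t₂` for `b ≤ x`. -/
noncomputable def brokenLine (b s₁ t₁ s₂ t₂ x : ℝ) : ℝ :=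
  if x < b then s₁ * x + t₁ else s₂ * x + t₂

theorem sum_brokenLine {M : Type*} [AddCommMonoid M] {a b c : ℝ} (hab : a ≤ b)
    (hbc : b ≤ c) (s₁ t₁ s₂ t₂ : ℝ) (g : ℕ → ℝ → M) :
    ∑ u ∈ Finset.Ico ⌈a⌉₊ (⌊c⌋₊ + 1), g u (brokenLine b s₁ t₁ s₂ t₂ u) =
      ∑ u ∈ Finset.Ico ⌈a⌉₊ ⌈b⌉₊, g u (s₁ * u + t₁) +
        ∑ u ∈ Finset.Ico ⌈b⌉₊ (⌊c⌋₊ + 1), g u (s₂ * u + t₂) := by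
  have h1 := ceil_le_floor_add_one hbc
  rw [← Finset.sum_Ico_consecutive _ (Nat.ceil_mono hab) h1]
  congr 1 <;> refine Finset.sum_congr rfl fun u hu => ?_ <;> rw [Finset.mem_Ico] at hu
  · rw [brokenLine, if_pos (Nat.lt_ceil.1 hu.2)]
  · rw [brokenLine, if_neg (not_lt.2 (Nat.ceil_le.1 hu.1))]

theorem intervalIntegrable_brokenLine (b s₁ t₁ s₂ t₂ u v : ℝ) :
    IntervalIntegrable (brokenLine b s₁ t₁ s₂ t₂) volume u v := by
  rw [intervalIntegrable_iff]
  refine Integrable.piecewise (s := Set.Iio b) measurableSet_Iio ?_ ?_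
  · exact (intervalIntegrable_iff.1 (Continuous.intervalIntegrable (by fun_prop) u v)).integrableOn
  · exact (intervalIntegrable_iff.1 (Continuous.intervalIntegrable (by fun_prop) u v)).integrableOn

theorem integral_brokenLine {a b c : ℝ} (hab : a ≤ b) (hbc : b ≤ c) (s₁ t₁ s₂ t₂ : ℝ) :
    ∫ x in a..c, brokenLine b s₁ t₁ s₂ t₂ x =
      (∫ x in a..b, (s₁ * x + t₁)) + ∫ x in b..c, (s₂ * x + t₂) := by
  rw [← intervalIntegral.integral_add_adjacent_intervals (b := b)
    (intervalIntegrable_brokenLine ..) (intervalIntegrable_brokenLine ..)]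
  congr 1
  · rw [intervalIntegral.integral_of_le hab, intervalIntegral.integral_of_le hab,
      integral_Ioc_eq_integral_Ioo, integral_Ioc_eq_integral_Ioo]
    refine setIntegral_congr_fun measurableSet_Ioo fun x hx => ?_
    simp only [brokenLine, if_pos hx.2]
  · refine intervalIntegral.integral_congr fun x hx => ?_
    rw [Set.uIcc_of_le hbc] at hx
    simp only [brokenLine, if_neg (not_lt.2 hx.1)]

theorem toReal_volume_eq_integral {S : Set (ℝ × ℝ)} (hSm : MeasurableSet S) {a c : ℝ}
    (hac : a ≤ c) {l h : ℝ → ℝ}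
    (hmem : ∀ x y, (x, y) ∈ S ↔ (a ≤ x ∧ x ≤ c) ∧ l x ≤ y ∧ y ≤ h x)
    (hlh : ∀ x, a ≤ x → x ≤ c → l x ≤ h x)
    (hl : IntervalIntegrable l volume a c) (hh : IntervalIntegrable h volume a c) :
    (volume S).toReal = (∫ x in a..c, h x) - ∫ x in a..c, l x := by
  rw [← intervalIntegral.integral_sub hh hl, intervalIntegral.integral_of_le hac,
    ← integral_Icc_eq_integral_Ioc, Measure.volume_eq_prod, Measure.prod_apply hSm]
  have hslice : ∀ x, volume (Prod.mk x ⁻¹' S) =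
      (Set.Icc a c).indicator (fun x => ENNReal.ofReal (h x - l x)) x := by
    intro x
    by_cases hx : x ∈ Set.Icc a c
    · rw [Set.indicator_of_mem hx, ← Real.volume_Icc]
      congr 1
      ext y
      rw [Set.mem_preimage, hmem]
      exact ⟨fun H => H.2, fun H => ⟨hx, H⟩⟩
    · rw [Set.indicator_of_notMem hx, ← measure_empty (μ := (volume : Measure ℝ))]
      congr 1
      ext y
      rw [Set.mem_preimage, hmem]
      exact ⟨fun H => hx H.1, False.elim⟩
  simp_rw [hslice]
  rw [lintegral_indicator measurableSet_Icc, ← ofReal_integral_eq_lintegral_ofReal]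
  · rw [ENNReal.toReal_ofReal]
    exact setIntegral_nonneg measurableSet_Icc fun x hx => sub_nonneg.2 (hlh x hx.1 hx.2)
  · rw [← IntegrableOn, integrableOn_Icc_iff_integrableOn_Ioc,
      ← intervalIntegrable_iff_integrableOn_Ioc_of_le hac]
    exact hh.sub hl
  · rw [Filter.EventuallyLE, ae_restrict_iff' measurableSet_Icc]
    exact Filter.Eventually.of_forall fun x hx => sub_nonneg.2 (hlh x hx.1 hx.2)

theorem abs_sum_affine_sub_integral_le_of_ceil_floor {s t a c P : ℝ} (ha0 : 0 ≤ a) (hac : a ≤ c)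
    (ha : s * a + t ∈ Set.Icc 0 P) (hc : s * c + t ∈ Set.Icc 0 P) :
    |∑ u ∈ Finset.Ico ⌈a⌉₊ (⌊c⌋₊ + 1), (s * u + t) - ∫ x in a..c, (s * x + t)| ≤ 2 * P :=
  abs_sum_affine_sub_integral_le (ceil_le_floor_add_one hac) hac (Nat.le_ceil a)
    (Nat.ceil_lt_add_one ha0).le le_floor_add_one
    (by push_cast; linarith [Nat.floor_le (ha0.trans hac)]) ha.1 ha.2 hc.1 hc.2

theorem abs_sum_brokenLine_sub_integral_le {s₁ t₁ s₂ t₂ a b c P : ℝ} (ha0 : 0 ≤ a) (hab : a ≤ b)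
    (hbc : b ≤ c) (ha : s₁ * a + t₁ ∈ Set.Icc 0 P) (hb₁ : s₁ * b + t₁ ∈ Set.Icc 0 P)
    (hb₂ : s₂ * b + t₂ ∈ Set.Icc 0 P) (hc : s₂ * c + t₂ ∈ Set.Icc 0 P) :
    |∑ u ∈ Finset.Ico ⌈a⌉₊ (⌊c⌋₊ + 1), brokenLine b s₁ t₁ s₂ t₂ u -
      ∫ x in a..c, brokenLine b s₁ t₁ s₂ t₂ x| ≤ 4 * P := by
  have hb0 := ha0.trans hab
  rw [sum_brokenLine hab hbc s₁ t₁ s₂ t₂ (fun _ x => x), integral_brokenLine hab hbc]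
  have h1 := abs_sum_affine_sub_integral_le (s := s₁) (t := t₁) (P := P) (Nat.ceil_mono hab) hab
    (Nat.le_ceil a) (Nat.ceil_lt_add_one ha0).le (Nat.le_ceil b) (Nat.ceil_lt_add_one hb0).le
    ha.1 ha.2 hb₁.1 hb₁.2
  have h2 := abs_sum_affine_sub_integral_le_of_ceil_floor hb0 hbc hb₂ hc
  rw [add_sub_add_comm]
  exact (abs_add_le _ _).trans (by linarith)

section Region

variable (p : ℕ) [Fact p.Prime]

theorem abs_sum_sawtooth_inv_sub_affine_le (hp : 100 ≤ p) {ε : ℤ} (hε : ε = 1 ∨ ε = -1)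
    (s t : ℝ) (m : ℕ) {n : ℕ} (hn : n ≤ p) :
    |∑ u ∈ Finset.Ico m n, sawtooth (ε * (((u : ZMod p)⁻¹.val : ℝ) - (s * u + t)) / p)| ≤
      3 * (p : ℝ) ^ (3 / 4 : ℝ) * Real.log p := by
  convert abs_sum_sawtooth_add_inv_le p hp hε (-ε * s / p) (-ε * t / p) m hn using 4
  ring

theorem abs_sum_sawtooth_inv_sub_brokenLine_le (hp : 100 ≤ p) {ε : ℤ} (hε : ε = 1 ∨ ε = -1)
    {a b c : ℝ} (hab : a ≤ b) (hbc : b ≤ c) (hc : ⌊c⌋₊ + 1 ≤ p) (s₁ t₁ s₂ t₂ : ℝ) :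
    |∑ u ∈ Finset.Ico ⌈a⌉₊ (⌊c⌋₊ + 1),
      sawtooth (ε * (((u : ZMod p)⁻¹.val : ℝ) - brokenLine b s₁ t₁ s₂ t₂ u) / p)| ≤
      6 * (p : ℝ) ^ (3 / 4 : ℝ) * Real.log p := by
  rw [sum_brokenLine hab hbc s₁ t₁ s₂ t₂
    (fun u x => sawtooth (ε * (((u : ZMod p)⁻¹.val : ℝ) - x) / p))]
  have h1 := abs_sum_sawtooth_inv_sub_affine_le p hp hε s₁ t₁ ⌈a⌉₊
    ((ceil_le_floor_add_one hbc).trans hc)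
  have h2 := abs_sum_sawtooth_inv_sub_affine_le p hp hε s₂ t₂ ⌈b⌉₊ hc
  exact (abs_add_le _ _).trans (by linarith)

theorem abs_invCount_sub_volume_le_of_sums {S : Set (ℝ × ℝ)} (hSm : MeasurableSet S)
    (hS : S ⊆ Set.Icc ((0 : ℝ), (0 : ℝ)) (((p : ℝ) - 1), ((p : ℝ) - 1)))
    {a c : ℝ} (ha : 0 ≤ a) (hac : a ≤ c) {l h : ℝ → ℝ}
    (hmem : ∀ x y, (x, y) ∈ S ↔ (a ≤ x ∧ x ≤ c) ∧ l x ≤ y ∧ y ≤ h x)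
    (hlh : ∀ x, a ≤ x → x ≤ c → l x ≤ h x)
    (hl : IntervalIntegrable l volume a c) (hh : IntervalIntegrable h volume a c)
    {Il Ih Sl Sh : ℝ}
    (hIl : |∑ u ∈ Finset.Ico ⌈a⌉₊ (⌊c⌋₊ + 1), l u - ∫ x in a..c, l x| ≤ Il * p)
    (hIh : |∑ u ∈ Finset.Ico ⌈a⌉₊ (⌊c⌋₊ + 1), h u - ∫ x in a..c, h x| ≤ Ih * p)
    (hSl : |∑ u ∈ Finset.Ico ⌈a⌉₊ (⌊c⌋₊ + 1),
      sawtooth (((1 : ℤ) : ℝ) * (((u : ZMod p)⁻¹.val : ℝ) - l u) / p)| ≤ Sl)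
    (hSh : |∑ u ∈ Finset.Ico ⌈a⌉₊ (⌊c⌋₊ + 1),
      sawtooth (((-1 : ℤ) : ℝ) * (((u : ZMod p)⁻¹.val : ℝ) - h u) / p)| ≤ Sh) :
    |(invCount p S : ℝ) - (volume S).toReal / p| ≤ 1 + Il + Ih + Sl + Sh := by
  have hp : (0 : ℝ) < p := by exact_mod_cast (Fact.out : p.Prime).pos
  have key := abs_invCount_sub_le p hS ha hac hmem hlh
  rw [toReal_volume_eq_integral hSm hac hmem hlh hl hh]
  simp only [Int.cast_one, one_mul, Int.cast_neg, neg_mul, neg_sub] at hSl hSh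
  rw [← Finset.sum_div, Finset.sum_sub_distrib] at key
  have e1 : (∑ u ∈ Finset.Ico ⌈a⌉₊ (⌊c⌋₊ + 1), h u - ∑ u ∈ Finset.Ico ⌈a⌉₊ (⌊c⌋₊ + 1), l u) / p -
      ((∫ x in a..c, h x) - ∫ x in a..c, l x) / p =
      (∑ u ∈ Finset.Ico ⌈a⌉₊ (⌊c⌋₊ + 1), h u - ∫ x in a..c, h x) / p -
      (∑ u ∈ Finset.Ico ⌈a⌉₊ (⌊c⌋₊ + 1), l u - ∫ x in a..c, l x) / p := by ring
  have h1 : |(∑ u ∈ Finset.Ico ⌈a⌉₊ (⌊c⌋₊ + 1), h u - ∫ x in a..c, h x) / p| ≤ Ih := by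
    rwa [abs_div, abs_of_pos hp, div_le_iff₀ hp]
  have h2 : |(∑ u ∈ Finset.Ico ⌈a⌉₊ (⌊c⌋₊ + 1), l u - ∫ x in a..c, l x) / p| ≤ Il := by
    rwa [abs_div, abs_of_pos hp, div_le_iff₀ hp]
  rw [abs_le] at *
  constructor <;> linarith [key.1, key.2, h1.1, h1.2, h2.1, h2.2, hSl.1, hSl.2, hSh.1, hSh.2]

theorem abs_invCount_sub_volume_le_of_region (hp : 100 ≤ p) {S : Set (ℝ × ℝ)}
    (hSm : MeasurableSet S)
    (hS : S ⊆ Set.Icc ((0 : ℝ), (0 : ℝ)) (((p : ℝ) - 1), ((p : ℝ) - 1)))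
    {a b c s₀ t₀ s₁ t₁ s₂ t₂ : ℝ} (ha : 0 ≤ a) (hab : a ≤ b) (hbc : b ≤ c) (hc : c ≤ (p : ℝ) - 1)
    (h₀a : s₀ * a + t₀ ∈ Set.Icc 0 (p : ℝ)) (h₀c : s₀ * c + t₀ ∈ Set.Icc 0 (p : ℝ))
    (h₁a : s₁ * a + t₁ ∈ Set.Icc 0 (p : ℝ)) (h₁b : s₁ * b + t₁ ∈ Set.Icc 0 (p : ℝ))
    (h₂b : s₂ * b + t₂ ∈ Set.Icc 0 (p : ℝ)) (h₂c : s₂ * c + t₂ ∈ Set.Icc 0 (p : ℝ))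
    (hmem : (∀ x y, (x, y) ∈ S ↔ (a ≤ x ∧ x ≤ c) ∧ s₀ * x + t₀ ≤ y ∧
        y ≤ brokenLine b s₁ t₁ s₂ t₂ x) ∧
        (∀ x, a ≤ x → x ≤ c → s₀ * x + t₀ ≤ brokenLine b s₁ t₁ s₂ t₂ x) ∨
      (∀ x y, (x, y) ∈ S ↔ (a ≤ x ∧ x ≤ c) ∧ brokenLine b s₁ t₁ s₂ t₂ x ≤ y ∧
        y ≤ s₀ * x + t₀) ∧
        (∀ x, a ≤ x → x ≤ c → brokenLine b s₁ t₁ s₂ t₂ x ≤ s₀ * x + t₀)) :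
    |(invCount p S : ℝ) - (volume S).toReal / p| ≤
      7 + 9 * (p : ℝ) ^ (3 / 4 : ℝ) * Real.log p := by
  have hac := hab.trans hbc
  have hcp : ⌊c⌋₊ + 1 ≤ p := by
    have : (⌊c⌋₊ : ℝ) < p := (Nat.floor_le (ha.trans hac)).trans_lt (by linarith)
    exact_mod_cast this
  have hI₀ := abs_sum_affine_sub_integral_le_of_ceil_floor ha hac h₀a h₀c
  have hI₁ := abs_sum_brokenLine_sub_integral_le ha hab hbc h₁a h₁b h₂b h₂c
  have hi₀ : IntervalIntegrable (fun x => s₀ * x + t₀) volume a c :=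
    Continuous.intervalIntegrable (by fun_prop) _ _
  have hi₁ := intervalIntegrable_brokenLine b s₁ t₁ s₂ t₂ a c
  rcases hmem with ⟨hmem, hle⟩ | ⟨hmem, hle⟩
  · refine (abs_invCount_sub_volume_le_of_sums p hSm hS ha hac hmem hle hi₀ hi₁ hI₀ hI₁
      (abs_sum_sawtooth_inv_sub_affine_le p hp (.inl rfl) s₀ t₀ _ hcp)
      (abs_sum_sawtooth_inv_sub_brokenLine_le p hp (.inr rfl) hab hbc hcp ..)).trans_eq ?_
    ring
  · refine (abs_invCount_sub_volume_le_of_sums p hSm hS ha hac hmem hle hi₁ hi₀ hI₁ hI₀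
      (abs_sum_sawtooth_inv_sub_brokenLine_le p hp (.inl rfl) hab hbc hcp ..)
      (abs_sum_sawtooth_inv_sub_affine_le p hp (.inr rfl) s₀ t₀ _ hcp)).trans_eq ?_
    ring

end Region

section Triangle

theorem Convex.mem_line {S : Set (ℝ × ℝ)} (hS : Convex ℝ S) {s t a b x : ℝ}
    (ha : (a, s * a + t) ∈ S) (hb : (b, s * b + t) ∈ S) (hax : a ≤ x) (hxb : x ≤ b) :
    (x, s * x + t) ∈ S := by
  have h : Convex ℝ {x : ℝ | (x, s * x + t) ∈ S} := by
    intro x hx y hy u v hu hv huv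
    have := hS hx hy hu hv huv
    simp only [Prod.smul_mk, Prod.mk_add_mk, smul_eq_mul] at this
    simp only [Set.mem_ofPred_eq, smul_eq_mul]
    convert this using 2
    linear_combination (-t) * huv
  exact h.ordConnected.out ha hb ⟨hax, hxb⟩

theorem Convex.mem_vertical {S : Set (ℝ × ℝ)} (hS : Convex ℝ S) {x l h y : ℝ}
    (hl : (x, l) ∈ S) (hh : (x, h) ∈ S) (hly : l ≤ y) (hyh : y ≤ h) : (x, y) ∈ S := by
  have h : Convex ℝ {y : ℝ | (x, y) ∈ S} := by
    intro y₁ h₁ y₂ h₂ u v hu hv huv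
    have := hS h₁ h₂ hu hv huv
    simp only [Prod.smul_mk, Prod.mk_add_mk, smul_eq_mul] at this
    simp only [Set.mem_ofPred_eq, smul_eq_mul]
    convert this using 2
    linear_combination (-x) * huv
  exact h.ordConnected.out hl hh ⟨hly, hyh⟩

theorem exists_of_mem_convexHull_triple {A B C z : ℝ × ℝ}
    (hz : z ∈ convexHull ℝ ({A, B, C} : Set (ℝ × ℝ))) :
    ∃ α β γ : ℝ, 0 ≤ α ∧ 0 ≤ β ∧ 0 ≤ γ ∧ α + β + γ = 1 ∧
      z.1 = α * A.1 + β * B.1 + γ * C.1 ∧ z.2 = α * A.2 + β * B.2 + γ * C.2 := by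
  rw [convexHull_insert (by simp), convexHull_pair] at hz
  simp only [convexJoin_singleton_left, Set.mem_iUnion] at hz
  obtain ⟨w, ⟨b, c, hb, hc, hbc, rfl⟩, u, v, hu, hv, huv, rfl⟩ := hz
  refine ⟨u, v * b, v * c, hu, by positivity, by positivity, ?_, ?_, ?_⟩
  · rw [add_assoc, ← mul_add, hbc, mul_one, huv]
  · simp; ring
  · simp; ring

variable {a b c ya yb yc s₀ t₀ s₁ t₁ s₂ t₂ σ : ℝ}

theorem mem_convexHull_triple_iff (hab : a ≤ b) (hbc : b ≤ c) (hac : a < c)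
    (h₀a : s₀ * a + t₀ = ya) (h₀c : s₀ * c + t₀ = yc)
    (h₁a : s₁ * a + t₁ = ya) (h₁b : a < b → s₁ * b + t₁ = yb)
    (h₂b : s₂ * b + t₂ = yb) (h₂c : b < c → s₂ * c + t₂ = yc)
    (hσ : σ = 1 ∨ σ = -1) (hD : 0 ≤ σ * (yb - (s₀ * b + t₀))) (x y : ℝ) :
    (x, y) ∈ convexHull ℝ ({(a, ya), (b, yb), (c, yc)} : Set (ℝ × ℝ)) ↔
      (a ≤ x ∧ x ≤ c) ∧ 0 ≤ σ * (y - (s₀ * x + t₀)) ∧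
        0 ≤ σ * (brokenLine b s₁ t₁ s₂ t₂ x - y) := by
  constructor
  · intro hxy
    obtain ⟨α, β, γ, hα, hβ, hγ, hsum, hx, hy⟩ := exists_of_mem_convexHull_triple hxy
    simp only at hx hy
    have hβ' : β = 1 - α - γ := by linarith
    have hax : a ≤ x := by
      rw [hx, hβ']; nlinarith
    have hxc : x ≤ c := by
      rw [hx, hβ']; nlinarith
    refine ⟨⟨hax, hxc⟩, ?_, ?_⟩
    · have : σ * (y - (s₀ * x + t₀)) = β * (σ * (yb - (s₀ * b + t₀))) := by
        rw [hx, hy, hβ', ← h₀a, ← h₀c]; ring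
      rw [this]; positivity
    · unfold brokenLine
      split_ifs with hxb
      · have hab' : a < b := hax.trans_lt hxb
        have h1 := h₁b hab'
        have e : (b - a) * (σ * (s₁ * c + t₁ - yc)) = (c - a) * (σ * (yb - (s₀ * b + t₀))) := by
          linear_combination σ * ((b - c) * (h₁a - h₀a) + (b - a) * h₀c + (c - a) * h1)
        have hpos : 0 ≤ σ * (s₁ * c + t₁ - yc) := by
          refine nonneg_of_mul_nonneg_right (e ▸ mul_nonneg (by linarith) hD) (by linarith)
        have : σ * (s₁ * x + t₁ - y) = γ * (σ * (s₁ * c + t₁ - yc)) := by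
          rw [hx, hy, hβ']
          linear_combination σ * (α * h₁a + (1 - α - γ) * h1)
        rw [this]; positivity
      · push Not at hxb
        rcases hbc.eq_or_lt with rfl | hbc'
        · have hα0 : α = 0 := by
            rw [hx, hβ'] at hxb
            nlinarith
          have : σ * (s₂ * x + t₂ - y) = (1 - β) * (σ * (yb - (s₀ * b + t₀))) := by
            rw [hx, hy, hβ', hα0]
            linear_combination σ * h₂b + σ * γ * h₀c
          rw [this]
          exact mul_nonneg (by linarith) hD
        · have h2 := h₂c hbc'
          have e : (c - b) * (σ * (s₂ * a + t₂ - ya)) =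
              (c - a) * (σ * (yb - (s₀ * b + t₀))) := by
            linear_combination σ * ((c - b) * h₀a + (b - a) * (h₀c - h2) + (c - a) * h₂b)
          have hpos : 0 ≤ σ * (s₂ * a + t₂ - ya) := by
            refine nonneg_of_mul_nonneg_right (e ▸ mul_nonneg (by linarith) hD) (by linarith)
          have : σ * (s₂ * x + t₂ - y) = α * (σ * (s₂ * a + t₂ - ya)) := by
            rw [hx, hy, hβ']
            linear_combination σ * (γ * h2 + (1 - α - γ) * h₂b)
          rw [this]; positivity
  · rintro ⟨⟨hax, hxc⟩, h1, h2⟩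
    set T := convexHull ℝ ({(a, ya), (b, yb), (c, yc)} : Set (ℝ × ℝ))
    have hT : Convex ℝ T := convex_convexHull ..
    have hA : (a, ya) ∈ T := subset_convexHull _ _ (by simp)
    have hB : (b, yb) ∈ T := subset_convexHull _ _ (by simp)
    have hC : (c, yc) ∈ T := subset_convexHull _ _ (by simp)
    have hm₀ : (x, s₀ * x + t₀) ∈ T :=
      hT.mem_line (by rwa [h₀a]) (by rwa [h₀c]) hax hxc
    have hm₁ : (x, brokenLine b s₁ t₁ s₂ t₂ x) ∈ T := by
      unfold brokenLine
      split_ifs with hxb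
      · exact hT.mem_line (by rwa [h₁a]) (by rwa [h₁b (hax.trans_lt hxb)]) hax hxb.le
      · push Not at hxb
        rcases hbc.eq_or_lt with rfl | hbc'
        · rw [le_antisymm hxc hxb, h₂b]
          exact hB
        · exact hT.mem_line (by rwa [h₂b]) (by rwa [h₂c hbc']) hxb hxc
    rcases hσ with rfl | rfl
    · exact hT.mem_vertical hm₀ hm₁ (by linarith) (by linarith)
    · exact hT.mem_vertical hm₁ hm₀ (by linarith) (by linarith)

end Triangle

theorem exists_sorted_triple (A B C : ℝ × ℝ) : ∃ A' B' C' : ℝ × ℝ,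
    ({A, B, C} : Set (ℝ × ℝ)) = {A', B', C'} ∧ A'.1 ≤ B'.1 ∧ B'.1 ≤ C'.1 := by
  rcases le_total A.1 B.1 with h1 | h1 <;> rcases le_total B.1 C.1 with h2 | h2 <;>
    rcases le_total A.1 C.1 with h3 | h3
  · exact ⟨A, B, C, rfl, h1, h2⟩
  · exact ⟨A, B, C, rfl, h1, h2⟩
  · exact ⟨A, C, B, by grind, h3, h2⟩
  · exact ⟨C, A, B, by grind, h3, h1⟩
  · exact ⟨B, A, C, by grind, h1, h3⟩
  · exact ⟨B, C, A, by grind, h2, h3⟩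
  · exact ⟨C, B, A, by grind, h2, h1⟩
  · exact ⟨C, B, A, by grind, h2, h1⟩

theorem toReal_volume_le_sq {P : ℝ} (hP : 0 ≤ P) {S : Set (ℝ × ℝ)}
    (hS : S ⊆ Set.Icc ((0 : ℝ), (0 : ℝ)) (P, P)) : (volume S).toReal ≤ P ^ 2 := by
  have h : volume S ≤ ENNReal.ofReal (P ^ 2) := by
    refine (measure_mono hS).trans_eq ?_
    rw [Set.Icc_prod_eq, Measure.volume_eq_prod, Measure.prod_prod, Real.volume_Icc,
      sub_zero, ← ENNReal.ofReal_mul hP, sq]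
  exact ENNReal.toReal_le_of_le_ofReal (sq_nonneg P) h

theorem volume_eq_zero_of_fst_eq {S : Set (ℝ × ℝ)} {a : ℝ} (hS : ∀ z ∈ S, z.1 = a) :
    volume S = 0 := by
  refine measure_mono_null (t := {a} ×ˢ Set.univ) (fun z hz => ⟨hS z hz, trivial⟩) ?_
  rw [Measure.volume_eq_prod, Measure.prod_prod]
  simp

theorem seven_lt_three_mul_rpow_mul_log {p : ℕ} (hp : 100 ≤ p) :
    7 < 3 * (p : ℝ) ^ ((3 : ℝ) / 4) * Real.log p := by
  have hp' : (100 : ℝ) ≤ p := by exact_mod_cast hp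
  have h1 : 3 ≤ Real.log p := by
    rw [Real.le_log_iff_exp_le (by linarith)]
    have : Real.exp 3 = Real.exp 1 ^ 3 := by rw [← Real.exp_nat_mul]; norm_num
    rw [this]
    calc (Real.exp 1 ^ 3 : ℝ) ≤ (3 : ℝ) ^ 3 := by
          gcongr
          exact Real.exp_one_lt_three.le
      _ ≤ p := by linarith
  have h2 : 1 ≤ (p : ℝ) ^ ((3 : ℝ) / 4) := Real.one_le_rpow (by linarith) (by norm_num)
  nlinarith

section Bounds

variable (p : ℕ) [Fact p.Prime]

theorem lt_twelve_mul_rpow_mul_log (hp : p < 100) :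
    (p : ℝ) < 12 * (p : ℝ) ^ ((3 : ℝ) / 4) * Real.log p := by
  have hp2 : (2 : ℝ) ≤ p := by exact_mod_cast (Fact.out : p.Prime).two_le
  have hp100 : (p : ℝ) < 100 := by exact_mod_cast hp
  have hp0 : (0 : ℝ) < p := by linarith
  have hlog : 0.69 < Real.log p :=
    (by linarith [Real.log_two_gt_d9] : 0.69 < Real.log 2).trans_le
      (Real.log_le_log (by norm_num) hp2)
  have hq : (p : ℝ) ^ ((1 : ℝ) / 4) ≤ 4 := by
    calc (p : ℝ) ^ ((1 : ℝ) / 4) ≤ ((4 : ℝ) ^ (4 : ℝ)) ^ ((1 : ℝ) / 4) := by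
          gcongr
          norm_num
          linarith
      _ = 4 := by
          rw [← Real.rpow_mul (by norm_num)]
          norm_num
  have hprod : (p : ℝ) = (p : ℝ) ^ ((3 : ℝ) / 4) * (p : ℝ) ^ ((1 : ℝ) / 4) := by
    rw [← Real.rpow_add hp0]
    norm_num
  have hP : 0 < (p : ℝ) ^ ((3 : ℝ) / 4) := by positivity
  calc (p : ℝ) = (p : ℝ) ^ ((3 : ℝ) / 4) * (p : ℝ) ^ ((1 : ℝ) / 4) := hprod
    _ ≤ (p : ℝ) ^ ((3 : ℝ) / 4) * 4 := by gcongr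
    _ < 12 * (p : ℝ) ^ ((3 : ℝ) / 4) * Real.log p := by nlinarith

theorem abs_invCount_sub_volume_le_prime {S : Set (ℝ × ℝ)}
    (hS : S ⊆ Set.Icc ((0 : ℝ), (0 : ℝ)) (((p : ℝ) - 1), ((p : ℝ) - 1))) :
    |(invCount p S : ℝ) - (volume S).toReal / p| ≤ p := by
  have hp1 : (1 : ℝ) ≤ p := by exact_mod_cast (Fact.out : p.Prime).one_le
  have h1 : (invCount p S : ℝ) ≤ p := by exact_mod_cast invCount_le p hS
  have h2 := toReal_volume_le_sq (by linarith) hS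
  have h3 : (volume S).toReal / p ≤ p := by
    rw [div_le_iff₀ (by linarith)]
    nlinarith
  have h4 : 0 ≤ (volume S).toReal / p := by positivity
  have h5 : (0 : ℝ) ≤ invCount p S := by positivity
  rw [abs_le]
  constructor <;> linarith

theorem abs_invCount_triangle_sub_volume_le (hp : 100 ≤ p) {a b c ya yb yc : ℝ} (hab : a ≤ b)
    (hbc : b ≤ c)
    (hsub : convexHull ℝ ({(a, ya), (b, yb), (c, yc)} : Set (ℝ × ℝ)) ⊆
      Set.Icc ((0 : ℝ), (0 : ℝ)) (((p : ℝ) - 1), ((p : ℝ) - 1))) :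
    |(invCount p (convexHull ℝ ({(a, ya), (b, yb), (c, yc)} : Set (ℝ × ℝ))) : ℝ) -
      (volume (convexHull ℝ ({(a, ya), (b, yb), (c, yc)} : Set (ℝ × ℝ)))).toReal / p| ≤
      7 + 9 * (p : ℝ) ^ ((3 : ℝ) / 4) * Real.log p := by
  have hp' : (100 : ℝ) ≤ p := by exact_mod_cast hp
  have hm : MeasurableSet (convexHull ℝ ({(a, ya), (b, yb), (c, yc)} : Set (ℝ × ℝ))) :=
    (Set.Finite.isCompact_convexHull (𝕜 := ℝ) (by simp)).measurableSet
  rcases (hab.trans hbc).eq_or_lt with rfl | hac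
  · obtain rfl := le_antisymm hab hbc
    have hx : ∀ z ∈ convexHull ℝ ({(a, ya), (a, yb), (a, yc)} : Set (ℝ × ℝ)), z.1 = a := by
      intro z hz
      obtain ⟨α, β, γ, -, -, -, hsum, hx, -⟩ := exists_of_mem_convexHull_triple hz
      rw [hx]
      linear_combination a * hsum
    have h1 : (invCount p (convexHull ℝ ({(a, ya), (a, yb), (a, yc)} : Set (ℝ × ℝ))) : ℝ) ≤ 1 := by
      exact_mod_cast invCount_le_one p hx hsub
    rw [volume_eq_zero_of_fst_eq hx, ENNReal.toReal_zero, zero_div, sub_zero,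
      abs_of_nonneg (by positivity)]
    have : 0 ≤ 9 * (p : ℝ) ^ ((3 : ℝ) / 4) * Real.log p :=
      mul_nonneg (by positivity) (Real.log_nonneg (by linarith))
    linarith
  · obtain ⟨⟨ha0, hya0⟩, -, hya⟩ := hsub (subset_convexHull ℝ _ (by simp : (a, ya) ∈ _))
    obtain ⟨⟨-, hyb0⟩, -, hyb⟩ := hsub (subset_convexHull ℝ _ (by simp : (b, yb) ∈ _))
    obtain ⟨⟨-, hyc0⟩, hc, hyc⟩ := hsub (subset_convexHull ℝ _ (by simp : (c, yc) ∈ _))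
    simp only at ha0 hya0 hya hyb0 hyb hyc0 hc hyc
    have hline : ∀ u v yu yv : ℝ, ∃ s t, s * u + t = yu ∧ (u < v → s * v + t = yv) := by
      intro u v yu yv
      rcases lt_or_ge u v with huv | huv
      · refine ⟨(yv - yu) / (v - u), yu - (yv - yu) / (v - u) * u, by ring, fun _ => ?_⟩
        have : v - u ≠ 0 := by linarith
        field_simp
        ring
      · exact ⟨0, yu, by ring, fun h => absurd h huv.not_gt⟩
    obtain ⟨s₀, t₀, h₀a, h₀c⟩ := hline a c ya yc
    obtain ⟨s₁, t₁, h₁a, h₁b⟩ := hline a b ya yb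
    obtain ⟨s₂, t₂, h₂b, h₂c⟩ := hline b c yb yc
    replace h₀c := h₀c hac
    have hA : ya ∈ Set.Icc 0 (p : ℝ) := ⟨hya0, by linarith⟩
    have hB : yb ∈ Set.Icc 0 (p : ℝ) := ⟨hyb0, by linarith⟩
    have hC : yc ∈ Set.Icc 0 (p : ℝ) := ⟨hyc0, by linarith⟩
    have hb₁ : s₁ * b + t₁ ∈ Set.Icc 0 (p : ℝ) := by
      rcases hab.eq_or_lt with rfl | h
      · rwa [h₁a]
      · rwa [h₁b h]
    have hc₂ : s₂ * c + t₂ ∈ Set.Icc 0 (p : ℝ) := by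
      rcases hbc.eq_or_lt with rfl | h
      · rwa [h₂b]
      · rwa [h₂c h]
    refine abs_invCount_sub_volume_le_of_region p hp hm hsub ha0 hab hbc hc
      (by rwa [h₀a]) (by rwa [h₀c]) (by rwa [h₁a]) hb₁ (by rwa [h₂b]) hc₂ ?_
    have hnonempty : ∀ x, a ≤ x → x ≤ c → (x, s₀ * x + t₀) ∈
        convexHull ℝ ({(a, ya), (b, yb), (c, yc)} : Set (ℝ × ℝ)) := fun x hax hxc =>
      (convex_convexHull ..).mem_line (by rw [h₀a]; exact subset_convexHull _ _ (by simp))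
        (by rw [h₀c]; exact subset_convexHull _ _ (by simp)) hax hxc
    rcases le_total (s₀ * b + t₀) yb with hD | hD
    · have key := mem_convexHull_triple_iff hab hbc hac h₀a h₀c h₁a h₁b h₂b h₂c (.inl rfl)
        (by linarith)
      refine .inl ⟨fun x y => ?_, fun x hax hxc => ?_⟩
      · rw [key, one_mul, one_mul, sub_nonneg, sub_nonneg]
      · have := ((key _ _).1 (hnonempty x hax hxc)).2.2
        linarith
    · have key := mem_convexHull_triple_iff hab hbc hac h₀a h₀c h₁a h₁b h₂b h₂c (.inr rfl)
        (by linarith)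
      refine .inr ⟨fun x y => ?_, fun x hax hxc => ?_⟩
      · rw [key, neg_one_mul, neg_one_mul, neg_sub, neg_sub, sub_nonneg, sub_nonneg]
        tauto
      · have := ((key _ _).1 (hnonempty x hax hxc)).2.2
        linarith

end Bounds

/-- For an arbitrary triangle `T ⊆ [0,p-1]²` (convex hull of three points),
the points `(x, x̄)` are equidistributed in `T`. -/
theorem stmt_15 (p : ℕ) (hp : p.Prime) (A B C : ℝ × ℝ)
    (hsub : convexHull ℝ ({A, B, C} : Set (ℝ × ℝ)) ⊆
      Set.Icc ((0 : ℝ), (0 : ℝ)) (((p : ℝ) - 1), ((p : ℝ) - 1))) :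
    |(invCount p (convexHull ℝ ({A, B, C} : Set (ℝ × ℝ))) : ℝ) -
        (volume (convexHull ℝ ({A, B, C} : Set (ℝ × ℝ)))).toReal / p|
      < 12 * (p : ℝ) ^ ((3 : ℝ) / 4) * Real.log p := by
  have := Fact.mk hp
  rcases lt_or_ge p 100 with hp100 | hp100
  · exact (abs_invCount_sub_volume_le_prime p hsub).trans_lt (lt_twelve_mul_rpow_mul_log p hp100)
  · obtain ⟨⟨a, ya⟩, ⟨b, yb⟩, ⟨c, yc⟩, hset, hab, hbc⟩ := exists_sorted_triple A B C
    rw [hset] at hsub ⊢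
    have h1 := abs_invCount_triangle_sub_volume_le p hp100 hab hbc hsub
    have h2 := seven_lt_three_mul_rpow_mul_log hp100
    linarith
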